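/- arXiv:math/0512606 — 4 statements merged into one kernel-verified Lean document; each statement's English description precedes it below -/
import Mathlib

section
/- Let V be a k-dimensional vector space of holomorphic functions on ℍ that is invariant under f(τ) ↦ f((aτ+b)/(cτ+d)) for every matrix [[a,b],[c,d]] ∈ SL(2,ℤ), with a basis f₁,…,f_k where f_i(τ) = e^{2πi h_i τ} g_i(e^{2πiτ}), h_i ∈ ℚ, h₁ < h₂ < ⋯ < h_k, and each g_i holomorphic on the open unit disk with g_i(0) ≠ 0. Assume: (i) the Wronskian W_V = W_{(q d/dq)}(f₁,…,f_k) is nowhere zero on ℍ; (ii) there exist an integer r ≥ ⌊k/6⌋ and indices i₀,…,i_r with h_{i_j} = j for j = 0,…,r. Then the Wronskian of derivatives W′_V = W_{(q d/dq)}((q d/dq)f₁,…,(q d/dq)f_k) vanishes identically on ℍ. If in addition i₀,…,i_r are the only indices i with h_i ∈ ℤ, then there exist complex constants λ₀,…,λ_r and C ≠ 0 such that λ₀ f_{i₀}(τ) + ⋯ + λ_r f_{i_r}(τ) = C for all τ ∈ ℍ. -/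
open Complex Finset

/-- The Ramanujan derivative `(q d/dq) f = (2πi)⁻¹ df/dτ`. -/
noncomputable def ramD : (ℂ → ℂ) → (ℂ → ℂ) :=
  fun f τ => (2 * (Real.pi : ℂ) * I)⁻¹ * deriv f τ

/-- The upper half-plane as a subset of `ℂ`. -/
def UHP : Set ℂ := {z : ℂ | 0 < z.im}

section Aux

open scoped MatrixGroups ModularForm Manifold
open scoped UpperHalfPlane
open UpperHalfPlane (atImInfty IsBoundedAtImInfty)

/-- A weakly modular function of weight `w < 12 n`, vanishing to order `n` at infinity, is zero. -/
lemma modZero_step (w : ℤ) (F : ℍ → ℂ) (n : ℕ)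
    (hs : ∀ γ : SL(2, ℤ), F ∣[w] γ = F) (γ : SL(2, ℤ)) :
    (fun z ↦ F z / ModularForm.discriminant z ^ n) ∣[w - 12 * n] γ =
      fun z ↦ F z / ModularForm.discriminant z ^ n := by
  ext z
  have h1 := congrFun (hs γ) z
  have h2 : (ModularForm.discriminant ∣[(12 : ℤ)] γ) z = ModularForm.discriminant z := by
    have hγ : (γ : GL (Fin 2) ℝ) ∈ 𝒮ℒ := ⟨γ, rfl⟩
    have := SlashInvariantFormClass.slash_action_eq CuspForm.discriminant
      (γ : GL (Fin 2) ℝ) hγ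
    exact congrFun this z
  rw [ModularForm.SL_slash_apply] at h1 h2 ⊢
  have hd := UpperHalfPlane.denom_ne_zero γ z
  have hD := ModularForm.discriminant_ne_zero z
  have hD2 := ModularForm.discriminant_ne_zero (γ • z)
  have e : UpperHalfPlane.denom γ z ^ (-(w - 12 * (n : ℤ))) =
      UpperHalfPlane.denom γ z ^ (-w) / (UpperHalfPlane.denom γ z ^ (-(12 : ℤ))) ^ n := by
    rw [← zpow_natCast, ← zpow_mul, ← zpow_sub₀ hd]
    congr 1; ring
  rw [← h1, ← h2, e, mul_pow]
  have := zpow_ne_zero (-(12:ℤ)) hd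
  field_simp

lemma modZero (w : ℤ) (F : ℍ → ℂ) (n : ℕ) (hn : w < 12 * n)
    (hF : MDiff F)
    (hs : ∀ γ : SL(2, ℤ), F ∣[w] γ = F)
    (hO : F =O[atImInfty] fun τ : ℍ => (Real.exp (-2 * Real.pi * τ.im)) ^ n) : F = 0 := by
  let H : ModularForm 𝒮ℒ (w - 12 * n) :=
    { toFun := fun z ↦ F z / ModularForm.discriminant z ^ n
      slash_action_eq' := fun _ ⟨γ, hγ⟩ ↦ hγ ▸ modZero_step w F n hs γ
      holo' := hF.div (CuspForm.discriminant.holo'.pow n)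
        fun z => pow_ne_zero _ (ModularForm.discriminant_ne_zero z)
      bdd_at_cusps' := by
        intro c hc
        rw [Subgroup.IsArithmetic.isCusp_iff_isCusp_SL2Z] at hc
        rw [OnePoint.isBoundedAt_iff_forall_SL2Z hc]
        intro γ _
        rw [modZero_step w F n hs γ, IsBoundedAtImInfty, Filter.BoundedAtFilter]
        exact (Asymptotics.div_isBoundedUnder_of_isBigO
          (hO.trans (ModularForm.exp_isBigO_discriminant.pow n))).isBigO_one ℝ }
  have h0 : ⇑H = 0 := ModularFormClass.levelOne_neg_weight_eq_zero (by linarith) H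
  ext z
  have := congrFun h0 z
  have h2 : F z / ModularForm.discriminant z ^ n = 0 := this
  simpa [ModularForm.discriminant_ne_zero z] using h2

end Aux

section Deriv

lemma isOpen_UHP : IsOpen UHP := isOpen_lt continuous_const Complex.continuous_im

lemma ramD_congr {u v : ℂ → ℂ} (huv : Set.EqOn u v UHP) : Set.EqOn (ramD u) (ramD v) UHP := by
  intro τ hτ
  unfold ramD
  rw [Filter.EventuallyEq.deriv_eq (huv.eventuallyEq_of_mem (isOpen_UHP.mem_nhds hτ))]

lemma ramD_iter_congr {u v : ℂ → ℂ} (huv : Set.EqOn u v UHP) (n : ℕ) :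
    Set.EqOn (ramD^[n] u) (ramD^[n] v) UHP := by
  induction n with
  | zero => simpa using huv
  | succ n ih =>
    rw [Function.iterate_succ_apply', Function.iterate_succ_apply']
    exact ramD_congr ih

lemma ramD_diff {u : ℂ → ℂ} (hu : DifferentiableOn ℂ u UHP) :
    DifferentiableOn ℂ (ramD u) UHP :=
  (hu.deriv isOpen_UHP).const_mul _

lemma ramD_iter_diff {u : ℂ → ℂ} (hu : DifferentiableOn ℂ u UHP) (n : ℕ) :
    DifferentiableOn ℂ (ramD^[n] u) UHP := by
  induction n with
  | zero => simpa using hu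
  | succ n ih =>
    rw [Function.iterate_succ_apply']
    exact ramD_diff ih

lemma UHP_diffAt {u : ℂ → ℂ} (hu : DifferentiableOn ℂ u UHP) {τ : ℂ} (hτ : τ ∈ UHP) :
    DifferentiableAt ℂ u τ := hu.differentiableAt (isOpen_UHP.mem_nhds hτ)

lemma ramD_sum {ι : Type*} (s : Finset ι) (a : ι → ℂ) (u : ι → ℂ → ℂ)
    (hu : ∀ i, DifferentiableOn ℂ (u i) UHP) {τ : ℂ} (hτ : τ ∈ UHP) :
    ramD (fun z => ∑ i ∈ s, a i * u i z) τ = ∑ i ∈ s, a i * ramD (u i) τ := by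
  unfold ramD
  have : HasDerivAt (fun z => ∑ i ∈ s, a i * u i z) (∑ i ∈ s, a i * deriv (u i) τ) τ :=
    HasDerivAt.fun_sum fun i _ => (UHP_diffAt (hu i) hτ).hasDerivAt.const_mul (a i)
  rw [this.deriv, Finset.mul_sum]
  exact Finset.sum_congr rfl fun i _ => by ring

lemma ramD_iter_sum {ι : Type*} (s : Finset ι) (a : ι → ℂ) (u : ι → ℂ → ℂ)
    (hu : ∀ i, DifferentiableOn ℂ (u i) UHP) (n : ℕ) :
    ∀ τ ∈ UHP, ramD^[n] (fun z => ∑ i ∈ s, a i * u i z) τ = ∑ i ∈ s, a i * ramD^[n] (u i) τ := by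
  induction n with
  | zero => intro τ _; rfl
  | succ n ih =>
    intro τ hτ
    simp only [Function.iterate_succ_apply']
    rw [ramD_congr (fun τ hτ => ih τ hτ) hτ,
      ramD_sum s a _ (fun i => ramD_iter_diff (hu i) n) hτ]

lemma ramD_iter_one (n : ℕ) (τ : ℂ) : ramD^[n] (fun _ => 1) τ = if n = 0 then 1 else 0 := by
  cases n with
  | zero => simp
  | succ n =>
    have h0 : ramD (fun _ => 0) = fun _ => 0 := by funext z; simp [ramD]
    have h1 : ramD (fun _ => 1) = fun _ => 0 := by funext z; simp [ramD]
    rw [Function.iterate_succ_apply, h1, Function.iterate_fixed h0]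
    simp

/-- Coefficients in the iterated chain rule. -/
noncomputable def chainCoef (φ : ℂ → ℂ) : ℕ → ℕ → ℂ → ℂ
  | 0, 0 => fun _ => 1
  | 0, _ + 1 => fun _ => 0
  | i + 1, 0 => ramD (chainCoef φ i 0)
  | i + 1, m + 1 => fun τ => ramD (chainCoef φ i (m + 1)) τ + deriv φ τ * chainCoef φ i m τ

lemma ramD_zero : ramD (fun _ => 0) = fun _ => 0 := by funext z; simp [ramD]

lemma chainCoef_zero (φ : ℂ → ℂ) (i : ℕ) : chainCoef φ (i + 1) 0 = fun _ => 0 := by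
  induction i with
  | zero => funext z; simp [chainCoef, ramD]
  | succ i ih => rw [chainCoef, ih, ramD_zero]

lemma chainCoef_gt (φ : ℂ → ℂ) (i : ℕ) : ∀ m, i < m → chainCoef φ i m = fun _ => 0 := by
  induction i with
  | zero =>
    intro m hm
    obtain ⟨m, rfl⟩ := Nat.exists_eq_succ_of_ne_zero hm.ne'
    rfl
  | succ i ih =>
    intro m hm
    obtain ⟨m, rfl⟩ := Nat.exists_eq_succ_of_ne_zero (by omega : m ≠ 0)
    rw [Nat.succ_eq_add_one, chainCoef, ih _ (by omega), ih _ (by omega), ramD_zero]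
    simp

lemma chainCoef_diag (φ : ℂ → ℂ) (i : ℕ) (τ : ℂ) : chainCoef φ i i τ = deriv φ τ ^ i := by
  induction i with
  | zero => simp [chainCoef]
  | succ i ih =>
    rw [chainCoef, chainCoef_gt φ i _ (by omega), ramD_zero]
    simp [ih, pow_succ']

lemma chainCoef_diff {φ : ℂ → ℂ} (hφ : DifferentiableOn ℂ φ UHP) (i : ℕ) :
    ∀ m, DifferentiableOn ℂ (chainCoef φ i m) UHP := by
  induction i with
  | zero => intro m; cases m <;> exact differentiableOn_const _
  | succ i ih =>
    intro m
    cases m with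
    | zero => exact ramD_diff (ih 0)
    | succ m => exact (ramD_diff (ih _)).add ((hφ.deriv isOpen_UHP).mul (ih m))

lemma chain_rule {φ : ℂ → ℂ} (hφ : DifferentiableOn ℂ φ UHP) (hm : Set.MapsTo φ UHP UHP)
    {u : ℂ → ℂ} (hu : DifferentiableOn ℂ u UHP) (i : ℕ) :
    ∀ τ ∈ UHP, ramD^[i] (fun z => u (φ z)) τ =
      ∑ m ∈ range (i + 1), chainCoef φ i m τ * ramD^[m] u (φ τ) := by
  induction i with
  | zero => intro τ _; simp [chainCoef]
  | succ i ih =>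
    intro τ hτ
    rw [Function.iterate_succ_apply', ramD_congr (fun τ hτ => ih τ hτ) hτ]
    have hd : HasDerivAt (fun τ => ∑ m ∈ range (i + 1), chainCoef φ i m τ * ramD^[m] u (φ τ))
        (∑ m ∈ range (i + 1), (deriv (chainCoef φ i m) τ * ramD^[m] u (φ τ) +
          chainCoef φ i m τ * (deriv (ramD^[m] u) (φ τ) * deriv φ τ))) τ :=
      HasDerivAt.fun_sum fun m _ =>
        (UHP_diffAt (chainCoef_diff hφ i m) hτ).hasDerivAt.mul
          ((UHP_diffAt (ramD_iter_diff hu m) (hm hτ)).hasDerivAt.comp τ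
            (UHP_diffAt hφ hτ).hasDerivAt)
    have h1 : ramD (fun τ => ∑ m ∈ range (i + 1), chainCoef φ i m τ * ramD^[m] u (φ τ)) τ =
        ∑ m ∈ range (i + 1), ramD (chainCoef φ i m) τ * ramD^[m] u (φ τ) +
        ∑ m ∈ range (i + 1), deriv φ τ * chainCoef φ i m τ * ramD^[m + 1] u (φ τ) := by
      rw [ramD, hd.deriv, Finset.mul_sum, ← Finset.sum_add_distrib]
      refine Finset.sum_congr rfl fun m _ => ?_
      rw [Function.iterate_succ_apply' ramD m u]
      simp only [ramD]
      ring
    rw [h1, Finset.sum_range_succ' _ (i + 1)]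
    simp only [chainCoef]
    simp only [add_mul, Finset.sum_add_distrib]
    have h2 : ∑ m ∈ range (i + 1), ramD (chainCoef φ i m) τ * ramD^[m] u (φ τ) =
        ∑ m ∈ range (i + 1), ramD (chainCoef φ i (m + 1)) τ * ramD^[m + 1] u (φ τ) +
          ramD (chainCoef φ i 0) τ * ramD^[0] u (φ τ) := by
      rw [← Finset.sum_range_succ' (fun m => ramD (chainCoef φ i m) τ * ramD^[m] u (φ τ)),
        Finset.sum_range_succ _ (i + 1), chainCoef_gt φ i (i + 1) (by omega), ramD_zero]
      simp
    rw [h2]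
    ring

lemma chain_rule_fin {φ : ℂ → ℂ} (hφ : DifferentiableOn ℂ φ UHP) (hm : Set.MapsTo φ UHP UHP)
    {u : ℂ → ℂ} (hu : DifferentiableOn ℂ u UHP) {k : ℕ} (i : Fin k) {τ : ℂ} (hτ : τ ∈ UHP) :
    ramD^[i] (fun z => u (φ z)) τ =
      ∑ m : Fin k, chainCoef φ i m τ * ramD^[m] u (φ τ) := by
  rw [chain_rule hφ hm hu i τ hτ,
    Fin.sum_univ_eq_sum_range (fun m => chainCoef φ i m τ * ramD^[m] u (φ τ)) k]
  refine Finset.sum_subset (fun m hm => ?_) fun m _ hm => ?_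
  · simp only [mem_range] at hm ⊢; omega
  · simp only [mem_range] at hm
    rw [chainCoef_gt φ i m (by omega)]; simp

lemma chain_rule_fin' {φ : ℂ → ℂ} (hφ : DifferentiableOn ℂ φ UHP) (hm : Set.MapsTo φ UHP UHP)
    {u : ℂ → ℂ} (hu : DifferentiableOn ℂ u UHP) {k : ℕ} (i : Fin k) {τ : ℂ} (hτ : τ ∈ UHP) :
    ramD^[(i : ℕ) + 1] (fun z => u (φ z)) τ =
      ∑ m : Fin k, chainCoef φ (i + 1) (m + 1) τ * ramD^[(m : ℕ) + 1] u (φ τ) := by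
  have := chain_rule_fin hφ hm hu i.succ hτ
  rw [Fin.sum_univ_succ] at this
  simpa [chainCoef_zero] using this

/-- Transformation of the two Wronskians under a holomorphic substitution preserving `V`. -/
lemma wronskian_transform {k : ℕ} {φ : ℂ → ℂ} (hφ : DifferentiableOn ℂ φ UHP)
    (hm : Set.MapsTo φ UHP UHP) (f : Fin k → ℂ → ℂ) (hf : ∀ i, DifferentiableOn ℂ (f i) UHP)
    (A : Fin k → Fin k → ℂ)
    (hA : ∀ i, ∀ τ ∈ UHP, f i (φ τ) = ∑ l, A i l * f l τ)
    {τ : ℂ} (hτ : τ ∈ UHP) :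
    (Matrix.of fun i j : Fin k => (ramD^[(i : ℕ)] (f j)) τ).det * (Matrix.of A).det =
      (∏ i : Fin k, deriv φ τ ^ (i : ℕ)) *
        (Matrix.of fun i j : Fin k => (ramD^[(i : ℕ)] (f j)) (φ τ)).det ∧
    (Matrix.of fun i j : Fin k => (ramD^[(i : ℕ) + 1] (f j)) τ).det * (Matrix.of A).det =
      (∏ i : Fin k, deriv φ τ ^ (i : ℕ)) * deriv φ τ ^ k *
        (Matrix.of fun i j : Fin k => (ramD^[(i : ℕ) + 1] (f j)) (φ τ)).det := by
  have key : ∀ (n : ℕ) (j : Fin k),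
      ∑ l, ramD^[n] (f l) τ * A j l = ramD^[n] (fun z => f j (φ z)) τ := by
    intro n j
    rw [ramD_iter_congr (fun τ hτ => hA j τ hτ) n hτ, ramD_iter_sum _ _ _ hf n τ hτ]
    exact Finset.sum_congr rfl fun l _ => mul_comm _ _
  constructor
  · have h1 : (Matrix.of fun i m : Fin k => chainCoef φ i m τ).det =
        ∏ i : Fin k, deriv φ τ ^ (i : ℕ) := by
      rw [Matrix.det_of_isLowerTriangular]
      · simp [chainCoef_diag]
      · intro i j hij
        simp [chainCoef_gt φ i j hij]
    rw [← h1, ← Matrix.det_transpose (Matrix.of A), ← Matrix.det_mul, ← Matrix.det_mul]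
    congr 1
    ext i j
    simp only [Matrix.mul_apply, Matrix.of_apply, Matrix.transpose_apply]
    rw [key, chain_rule_fin hφ hm (hf j) i hτ]
  · have h1 : (Matrix.of fun i m : Fin k => chainCoef φ (i + 1) (m + 1) τ).det =
        (∏ i : Fin k, deriv φ τ ^ (i : ℕ)) * deriv φ τ ^ k := by
      rw [Matrix.det_of_isLowerTriangular]
      · simp [chainCoef_diag, pow_succ, Finset.prod_mul_distrib]
      · intro i j hij
        have hij' : (i : ℕ) < j := hij
        simp [chainCoef_gt φ (i + 1) (j + 1) (by omega)]
    rw [← h1, ← Matrix.det_transpose (Matrix.of A), ← Matrix.det_mul, ← Matrix.det_mul]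
    congr 1
    ext i j
    simp only [Matrix.mul_apply, Matrix.of_apply, Matrix.transpose_apply]
    rw [key, chain_rule_fin' hφ hm (hf j) i hτ]

end Deriv

section QExp

/-- `q = e^{2πiτ}`. -/
noncomputable def qq (τ : ℂ) : ℂ := Complex.exp (2 * (Real.pi : ℂ) * I * τ)

/-- `e^{2πihτ}`. -/
noncomputable def ee (h τ : ℂ) : ℂ := Complex.exp (2 * (Real.pi : ℂ) * I * h * τ)

lemma norm_qq (τ : ℂ) : ‖qq τ‖ = Real.exp (-2 * Real.pi * τ.im) := by
  simp [qq, Complex.norm_exp]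

lemma qq_mem {τ : ℂ} (hτ : τ ∈ UHP) : qq τ ∈ Metric.ball (0 : ℂ) 1 := by
  rw [mem_ball_zero_iff, norm_qq, Real.exp_lt_one_iff]
  have : 0 < τ.im := hτ
  have := Real.pi_pos
  nlinarith [mul_pos Real.pi_pos ‹0 < τ.im›]

lemma ee_nat (n : ℕ) (τ : ℂ) : ee n τ = qq τ ^ n := by
  rw [ee, qq, ← Complex.exp_nat_mul]; congr 1; ring

lemma ee_ne (h τ : ℂ) : ee h τ ≠ 0 := Complex.exp_ne_zero _

/-- The operator on `q`-functions corresponding to `q d/dq` on `q^h G(q)`. -/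
noncomputable def TT (h : ℂ) (G : ℂ → ℂ) : ℂ → ℂ := fun q => h * G q + q * deriv G q

lemma TT_diff (h : ℂ) {G : ℂ → ℂ} (hG : DifferentiableOn ℂ G (Metric.ball 0 1)) :
    DifferentiableOn ℂ (TT h G) (Metric.ball 0 1) :=
  (hG.const_mul h).add (differentiableOn_id.mul (hG.deriv Metric.isOpen_ball))

lemma TT_iter_diff (h : ℂ) {G : ℂ → ℂ} (hG : DifferentiableOn ℂ G (Metric.ball 0 1)) (n : ℕ) :
    DifferentiableOn ℂ ((TT h)^[n] G) (Metric.ball 0 1) := by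
  induction n with
  | zero => simpa using hG
  | succ n ih => rw [Function.iterate_succ_apply']; exact TT_diff h ih

lemma TT_iter_zero (h : ℂ) (G : ℂ → ℂ) (n : ℕ) : (TT h)^[n] G 0 = h ^ n * G 0 := by
  induction n with
  | zero => simp
  | succ n ih => rw [Function.iterate_succ_apply', TT, ih]; ring

lemma hasDerivAt_qq (τ : ℂ) : HasDerivAt qq (2 * (Real.pi : ℂ) * I * qq τ) τ := by
  have := ((hasDerivAt_id τ).const_mul (2 * (Real.pi : ℂ) * I)).cexp
  refine HasDerivAt.congr_deriv (f := qq) this ?_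
  simp [qq, mul_comm]

lemma hasDerivAt_ee (h τ : ℂ) : HasDerivAt (ee h) (2 * (Real.pi : ℂ) * I * h * ee h τ) τ := by
  have := ((hasDerivAt_id τ).const_mul (2 * (Real.pi : ℂ) * I * h)).cexp
  refine HasDerivAt.congr_deriv (f := ee h) this ?_
  simp [ee, mul_comm]

lemma hasDerivAt_eeG (h : ℂ) {G : ℂ → ℂ} (hG : DifferentiableOn ℂ G (Metric.ball 0 1))
    {τ : ℂ} (hτ : τ ∈ UHP) : HasDerivAt (fun z => ee h z * G (qq z))
      (2 * (Real.pi : ℂ) * I * (ee h τ * TT h G (qq τ))) τ := by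
  have h1 := (hG.differentiableAt (Metric.isOpen_ball.mem_nhds (qq_mem hτ))).hasDerivAt
  have h2 := (hasDerivAt_ee h τ).mul (h1.comp τ (hasDerivAt_qq τ))
  refine h2.congr_deriv ?_
  simp only [TT, Function.comp]
  ring

lemma ramD_eeG (h : ℂ) {G : ℂ → ℂ} (hG : DifferentiableOn ℂ G (Metric.ball 0 1))
    {τ : ℂ} (hτ : τ ∈ UHP) : ramD (fun z => ee h z * G (qq z)) τ = ee h τ * TT h G (qq τ) := by
  rw [ramD, (hasDerivAt_eeG h hG hτ).deriv]
  have := Complex.two_pi_I_ne_zero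
  field_simp

lemma ramD_iter_eeG (h : ℂ) {G : ℂ → ℂ} (hG : DifferentiableOn ℂ G (Metric.ball 0 1))
    {u : ℂ → ℂ} (hu : ∀ τ ∈ UHP, u τ = ee h τ * G (qq τ)) (n : ℕ) :
    ∀ τ ∈ UHP, ramD^[n] u τ = ee h τ * (TT h)^[n] G (qq τ) := by
  induction n with
  | zero => simpa using hu
  | succ n ih =>
    intro τ hτ
    rw [Function.iterate_succ_apply', ramD_congr (fun τ hτ => ih τ hτ) hτ,
      ramD_eeG h (TT_iter_diff h hG n) hτ, Function.iterate_succ_apply']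

lemma eeG_diff (h : ℂ) {G : ℂ → ℂ} (hG : DifferentiableOn ℂ G (Metric.ball 0 1))
    {u : ℂ → ℂ} (hu : ∀ τ ∈ UHP, u τ = ee h τ * G (qq τ)) : DifferentiableOn ℂ u UHP := by
  refine DifferentiableOn.congr (f := fun z => ee h z * G (qq z)) ?_ hu
  exact fun τ hτ => (hasDerivAt_eeG h hG hτ).differentiableAt.differentiableWithinAt

/-- Elimination of the first `n` Taylor coefficients. -/
lemma exists_elim (G : ℕ → ℂ → ℂ) (n : ℕ)
    (hG : ∀ i < n, DifferentiableOn ℂ (G i) (Metric.ball 0 1))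
    (hG0 : ∀ i < n, G i 0 ≠ 0) :
    ∃ (lam : ℕ → ℂ) (v : ℂ → ℂ), DifferentiableOn ℂ v (Metric.ball 0 1) ∧
      ∀ q : ℂ, 1 - ∑ j ∈ range n, lam j * (q ^ j * G j q) = q ^ n * v q := by
  induction n with
  | zero => exact ⟨fun _ => 0, fun _ => 1, differentiableOn_const _, by simp⟩
  | succ n ih =>
    obtain ⟨lam, v, hv, hlv⟩ := ih (fun i hi => hG i (by omega)) (fun i hi => hG0 i (by omega))
    set c := v 0 / G n 0 with hc
    set w : ℂ → ℂ := fun q => v q - c * G n q with hw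
    have hw0 : w 0 = 0 := by
      simp only [hw, hc]
      rw [div_mul_cancel₀ _ (hG0 n (by omega)), sub_self]
    have hwd : DifferentiableOn ℂ w (Metric.ball 0 1) :=
      hv.sub ((hG n (by omega)).const_mul c)
    refine ⟨Function.update lam n c, dslope w 0, ?_, fun q => ?_⟩
    · rw [Complex.differentiableOn_dslope (Metric.ball_mem_nhds 0 one_pos)]
      exact hwd
    · rw [Finset.sum_range_succ, Finset.sum_congr rfl (g := fun j => lam j * (q ^ j * G j q))]
      · have h1 := sub_smul_dslope w 0 q
        simp only [sub_zero, hw0, smul_eq_mul] at h1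
        rw [pow_succ, mul_assoc, h1, Function.update_self, ← sub_sub, hlv]
        simp only [hw]; ring
      · intro j hj
        rw [Function.update_of_ne]
        simp only [mem_range] at hj; omega

end QExp

section Wronsk

/-- The bordered Wronskian. -/
lemma det_border {k : ℕ} (M : ℕ → Fin k → ℂ) (mu : Fin k → ℂ) :
    (Matrix.of fun i j : Fin (k + 1) => (Fin.cases (motive := fun _ => ℂ)
      ((if (i : ℕ) = 0 then 1 else 0) - ∑ l, mu l * M i l) (fun l => M i l) j : ℂ)).det =
    (Matrix.of fun i j : Fin k => M (i + 1) j).det := by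
  set N1 : Matrix (Fin (k + 1)) (Fin (k + 1)) ℂ :=
    Matrix.of fun i j : Fin (k + 1) => (Fin.cases (motive := fun _ => ℂ)
      (if (i : ℕ) = 0 then 1 else 0) (fun l => M i l) j : ℂ) with hN1
  set Lm : Matrix (Fin (k + 1)) (Fin (k + 1)) ℂ :=
    Matrix.of fun a b : Fin (k + 1) => (Fin.cases (motive := fun _ => ℂ)
      (Fin.cases (motive := fun _ => ℂ) 1 (fun l => - mu l) a)
      (fun l => if a = l.succ then 1 else 0) b : ℂ) with hLm
  have h1 : (Matrix.of fun i j : Fin (k + 1) => (Fin.cases (motive := fun _ => ℂ)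
      ((if (i : ℕ) = 0 then 1 else 0) - ∑ l, mu l * M i l) (fun l => M i l) j : ℂ)) =
      N1 * Lm := by
    ext i j
    rw [Matrix.mul_apply]
    refine Fin.cases ?_ (fun l => ?_) j
    · rw [Fin.sum_univ_succ]
      simp only [hN1, hLm, Matrix.of_apply, Fin.cases_zero, Fin.cases_succ, mul_one, mul_neg,
        Finset.sum_neg_distrib, ← sub_eq_add_neg]
      congr 1
      exact Finset.sum_congr rfl fun l _ => mul_comm _ _
    · simp [hN1, hLm]
  have h2 : Lm.det = 1 := by
    rw [Matrix.det_of_isLowerTriangular]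
    · refine Finset.prod_eq_one fun i _ => ?_
      refine Fin.cases ?_ (fun l => ?_) i
      · simp [hLm]
      · simp [hLm]
    · intro i j hij
      have hij' : i < j := hij
      obtain ⟨l, rfl⟩ := Fin.exists_succ_eq.mpr (Fin.ne_zero_of_lt hij')
      simp [hLm, hij'.ne]
  rw [h1, Matrix.det_mul, h2, mul_one, Matrix.det_succ_column_zero, Fin.sum_univ_succ]
  rw [Finset.sum_eq_zero]
  · simp only [hN1, Matrix.of_apply, Fin.val_zero, pow_zero, Fin.cases_zero, if_true, one_mul,
      add_zero]
    congr 1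
  · intro i _
    simp [hN1]

lemma det_continuousAt {n : ℕ} (K : Fin n → Fin n → ℂ → ℂ) (x : ℂ)
    (hK : ∀ i j, ContinuousAt (K i j) x) :
    ContinuousAt (fun q => (Matrix.of fun i j => K i j q).det) x := by
  simp only [Matrix.det_apply, Matrix.of_apply]
  refine tendsto_finsetSum _ fun σ _ => ?_
  exact ((tendsto_finsetProd _ fun i _ => hK _ _)).const_smul _

lemma det_differentiableOn {n : ℕ} (K : Fin n → Fin n → ℂ → ℂ) (s : Set ℂ)
    (hK : ∀ i j, DifferentiableOn ℂ (K i j) s) :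
    DifferentiableOn ℂ (fun q => (Matrix.of fun i j => K i j q).det) s := by
  simp only [Matrix.det_apply, Matrix.of_apply]
  refine DifferentiableOn.fun_sum fun σ _ => ?_
  refine DifferentiableOn.const_smul ?_ _
  exact DifferentiableOn.fun_finsetProd fun i _ => hK _ _

/-- Nonvanishing at `q = 0` of the leading coefficient of the Wronskian. -/
lemma lead_ne {k : ℕ} (h : Fin k → ℚ) (g : Fin k → ℂ → ℂ) (hg0 : ∀ i, g i 0 ≠ 0)
    (hmono : StrictMono h) :
    (Matrix.of fun i j : Fin k => (TT (h j))^[(i : ℕ)] (g j) 0).det ≠ 0 := by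
  have : (Matrix.of fun i j : Fin k => (TT (h j))^[(i : ℕ)] (g j) 0) =
      Matrix.of fun i j : Fin k => g j 0 * (Matrix.vandermonde fun j => (h j : ℂ)).transpose i j := by
    ext i j
    simp [TT_iter_zero, Matrix.vandermonde_apply, mul_comm]
  rw [this, Matrix.det_mul_row, Matrix.det_transpose]
  refine mul_ne_zero (Finset.prod_ne_zero_iff.mpr fun i _ => hg0 i) ?_
  rw [Matrix.det_vandermonde_ne_zero_iff]
  intro a b hab
  have hab' : (h a : ℂ) = (h b : ℂ) := hab
  exact hmono.injective (by exact_mod_cast hab')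

/-- The quotient of the Wronskians is `q^{r+1}` times a function continuous at `q = 0`. -/
lemma ratio_form {k : ℕ} (f : Fin k → ℂ → ℂ) (h : Fin k → ℚ) (g : Fin k → ℂ → ℂ)
    (hgdiff : ∀ i, DifferentiableOn ℂ (g i) (Metric.ball 0 1))
    (hg0 : ∀ i, g i 0 ≠ 0)
    (hmono : StrictMono h)
    (hf : ∀ i, ∀ τ ∈ UHP, f i τ = ee (h i) τ * g i (qq τ))
    (r : ℕ) (idx : Fin (r + 1) → Fin k)
    (hidx : ∀ j : Fin (r + 1), h (idx j) = ((j : ℕ) : ℚ)) :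
    ∃ Φ : ℂ → ℂ, ContinuousAt Φ 0 ∧ ∀ τ ∈ UHP,
      (Matrix.of fun i j : Fin k => (ramD^[(i : ℕ) + 1] (f j)) τ).det /
      (Matrix.of fun i j : Fin k => (ramD^[(i : ℕ)] (f j)) τ).det = qq τ ^ (r + 1) * Φ (qq τ) := by
  obtain ⟨lam, v, hv, hlv⟩ := exists_elim
    (fun n => if hn : n < r + 1 then g (idx ⟨n, hn⟩) else fun _ => 1) (r + 1)
    (fun i hi => by simpa [hi] using hgdiff _) (fun i hi => by simpa [hi] using hg0 _)
  -- coefficients on all of `Fin k`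
  set mu : Fin k → ℂ := fun l => ∑ j : Fin (r + 1), if idx j = l then lam j else 0 with hmu
  have hsum : ∀ c : Fin k → ℂ, ∑ l, mu l * c l = ∑ j : Fin (r + 1), lam j * c (idx j) := by
    intro c
    simp only [hmu, Finset.sum_mul]
    rw [Finset.sum_comm]
    refine Finset.sum_congr rfl fun j _ => ?_
    simp [ite_mul]
  set u : ℂ → ℂ := fun z => ∑ l : Option (Fin k), (Option.elim l 1 fun l => - mu l) *
    (Option.elim l (fun _ => 1) fun l => f l : ℂ → ℂ) z with hu
  have hfd : ∀ i, DifferentiableOn ℂ (f i) UHP := fun i => eeG_diff (h i) (hgdiff i) (hf i)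
  have huq : ∀ τ ∈ UHP, u τ = ee ((r + 1 : ℕ) : ℂ) τ * v (qq τ) := by
    intro τ hτ
    rw [ee_nat, ← hlv]
    simp only [hu, Fintype.sum_option, Option.elim_none, Option.elim_some, mul_one, neg_mul,
      Finset.sum_neg_distrib, ← sub_eq_add_neg]
    rw [hsum fun l => f l τ, ← Fin.sum_univ_eq_sum_range (fun j => lam j * (qq τ ^ j *
      (if hn : j < r + 1 then g (idx ⟨j, hn⟩) else fun _ => 1) (qq τ)))]
    congr 1
    refine Finset.sum_congr rfl fun j _ => ?_
    rw [hf _ τ hτ, hidx]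
    have hj : (j : ℕ) ≤ r := by omega
    simp [← ee_nat, hj]
  have huD : ∀ (n : ℕ), ∀ τ ∈ UHP, ramD^[n] u τ =
      (if n = 0 then 1 else 0) - ∑ l, mu l * ramD^[n] (f l) τ := by
    intro n τ hτ
    rw [hu, ramD_iter_sum _ _ _ _ n τ hτ]
    · simp [Fintype.sum_option, ramD_iter_one, ← sub_eq_add_neg]
    · intro i
      cases i with
      | none => exact differentiableOn_const _
      | some l => exact hfd l
  set K : Fin (k + 1) → Fin (k + 1) → ℂ → ℂ := fun i j =>
    Fin.cases (motive := fun _ => ℂ → ℂ) ((TT ((r + 1 : ℕ) : ℂ))^[(i : ℕ)] v)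
      (fun l => (TT (h l))^[(i : ℕ)] (g l)) j with hK
  have h0 : Metric.ball (0 : ℂ) 1 ∈ nhds 0 := Metric.ball_mem_nhds 0 one_pos
  refine ⟨fun q => (Matrix.of fun i j => K i j q).det /
    (Matrix.of fun i j : Fin k => (TT (h j))^[(i : ℕ)] (g j) q).det, ?_, ?_⟩
  · refine ContinuousAt.div (det_continuousAt _ _ ?_)
      (det_continuousAt (fun i j : Fin k => (TT (h j))^[(i : ℕ)] (g j)) _ ?_)
      (lead_ne h g hg0 hmono)
    · intro i j
      refine Fin.cases ?_ (fun l => ?_) j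
      · exact ((TT_iter_diff _ hv i).differentiableAt h0).continuousAt
      · exact ((TT_iter_diff _ (hgdiff l) i).differentiableAt h0).continuousAt
    · intro i j
      exact ((TT_iter_diff _ (hgdiff j) i).differentiableAt h0).continuousAt
  · intro τ hτ
    have e1 : (Matrix.of fun i j : Fin k => (ramD^[(i : ℕ)] (f j)) τ).det =
        (∏ j, ee (h j) τ) * (Matrix.of fun i j : Fin k => (TT (h j))^[(i : ℕ)] (g j) (qq τ)).det := by
      rw [← Matrix.det_mul_row]
      congr 1
      ext i j
      simp only [Matrix.of_apply]
      exact ramD_iter_eeG (h j) (hgdiff j) (hf j) i τ hτ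
    have e2 : (Matrix.of fun i j : Fin k => (ramD^[(i : ℕ) + 1] (f j)) τ).det =
        qq τ ^ (r + 1) * (∏ j, ee (h j) τ) * (Matrix.of fun i j => K i j (qq τ)).det := by
      rw [← det_border (fun n j => ramD^[n] (f j) τ) mu, ← ee_nat]
      have : ee ((r + 1 : ℕ) : ℂ) τ * ∏ j, ee (h j) τ = ∏ j : Fin (k + 1),
          (Fin.cases (motive := fun _ => ℂ) (ee ((r + 1 : ℕ) : ℂ) τ) (fun l => ee (h l) τ) j : ℂ) := by
        rw [Fin.prod_univ_succ]; simp
      rw [this, ← Matrix.det_mul_row]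
      congr 1
      ext i j
      simp only [Matrix.of_apply]
      refine Fin.cases ?_ (fun l => ?_) j
      · simp only [Fin.cases_zero, hK]
        rw [← huD i τ hτ, ramD_iter_eeG _ hv huq i τ hτ]
      · simp only [Fin.cases_succ, hK]
        exact ramD_iter_eeG (h l) (hgdiff l) (hf l) i τ hτ
    have hp : ∏ j, ee (h j) τ ≠ 0 := Finset.prod_ne_zero_iff.mpr fun j _ => ee_ne _ _
    rw [e1, e2, mul_right_comm, mul_comm (∏ j, ee (h j) τ), mul_div_mul_right _ _ hp, mul_div_assoc]

end Wronsk

section Main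

open scoped MatrixGroups ModularForm Manifold
open scoped UpperHalfPlane
open UpperHalfPlane (atImInfty)

/-- The Möbius transformation attached to an integral matrix. -/
noncomputable def moeb (γ : SL(2, ℤ)) (τ : ℂ) : ℂ :=
  ((((γ : Matrix (Fin 2) (Fin 2) ℤ) 0 0 : ℤ) : ℂ) * τ +
    (((γ : Matrix (Fin 2) (Fin 2) ℤ) 0 1 : ℤ) : ℂ)) /
  ((((γ : Matrix (Fin 2) (Fin 2) ℤ) 1 0 : ℤ) : ℂ) * τ +
    (((γ : Matrix (Fin 2) (Fin 2) ℤ) 1 1 : ℤ) : ℂ))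

lemma moeb_eq (γ : SL(2, ℤ)) (z : ℍ) : moeb γ z = ((γ • z : ℍ) : ℂ) := by
  rw [UpperHalfPlane.specialLinearGroup_apply]
  simp [moeb]

lemma moeb_hasDerivAt (γ : SL(2, ℤ)) (z : ℍ) :
    HasDerivAt (moeb γ) ((UpperHalfPlane.denom γ z ^ 2)⁻¹) z := by
  have hd := UpperHalfPlane.denom_ne_zero γ z
  rw [ModularGroup.denom_apply] at hd ⊢
  have hdet := γ.det_coe
  rw [Matrix.det_fin_two] at hdet
  have hdet' : (((γ : Matrix (Fin 2) (Fin 2) ℤ) 0 0 : ℤ) : ℂ) *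
      (((γ : Matrix (Fin 2) (Fin 2) ℤ) 1 1 : ℤ) : ℂ) -
      (((γ : Matrix (Fin 2) (Fin 2) ℤ) 0 1 : ℤ) : ℂ) *
      (((γ : Matrix (Fin 2) (Fin 2) ℤ) 1 0 : ℤ) : ℂ) = 1 := by exact_mod_cast hdet
  have h1 := (((hasDerivAt_id (z : ℂ)).const_mul
    (((γ : Matrix (Fin 2) (Fin 2) ℤ) 0 0 : ℤ) : ℂ)).add_const
      (((γ : Matrix (Fin 2) (Fin 2) ℤ) 0 1 : ℤ) : ℂ)).div
    (((hasDerivAt_id (z : ℂ)).const_mul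
    (((γ : Matrix (Fin 2) (Fin 2) ℤ) 1 0 : ℤ) : ℂ)).add_const
      (((γ : Matrix (Fin 2) (Fin 2) ℤ) 1 1 : ℤ) : ℂ)) hd
  refine HasDerivAt.congr_deriv (f := moeb γ) h1 ?_
  rw [inv_eq_one_div]
  congr 1
  simp only [id, mul_one]
  linear_combination hdet'

lemma part_one {k : ℕ}
    (f : Fin k → ℂ → ℂ) (h : Fin k → ℚ) (g : Fin k → ℂ → ℂ)
    (hgdiff : ∀ i, DifferentiableOn ℂ (g i) (Metric.ball 0 1))
    (hg0 : ∀ i, g i 0 ≠ 0)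
    (hmono : StrictMono h)
    (hf : ∀ i, ∀ τ ∈ UHP, f i τ = ee (h i) τ * g i (qq τ))
    (hmod : ∀ γ : SL(2, ℤ), ∀ i : Fin k,
      UHP.restrict (fun τ => f i (moeb γ τ)) ∈
        Submodule.span ℂ (Set.range fun i => UHP.restrict (f i)))
    (hWnz : ∀ τ ∈ UHP,
      Matrix.det (Matrix.of fun i j : Fin k => (ramD^[(i : ℕ)] (f j)) τ) ≠ 0)
    (r : ℕ) (hr : k / 6 ≤ r)
    (idx : Fin (r + 1) → Fin k)
    (hidx : ∀ j : Fin (r + 1), h (idx j) = ((j : ℕ) : ℚ)) :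
    ∀ τ ∈ UHP, (Matrix.of fun i j : Fin k => (ramD^[(i : ℕ) + 1] (f j)) τ).det = 0 := by
  have hfd : ∀ i, DifferentiableOn ℂ (f i) UHP := fun i => eeG_diff (h i) (hgdiff i) (hf i)
  set R : ℂ → ℂ := fun τ => (Matrix.of fun i j : Fin k => (ramD^[(i : ℕ) + 1] (f j)) τ).det /
      (Matrix.of fun i j : Fin k => (ramD^[(i : ℕ)] (f j)) τ).det with hR
  set F : ℍ → ℂ := fun z => R z with hFdef
  have hRd : DifferentiableOn ℂ R UHP := by
    refine DifferentiableOn.fun_div (det_differentiableOn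
      (fun i j : Fin k => ramD^[(i : ℕ) + 1] (f j)) UHP ?_) (det_differentiableOn
      (fun i j : Fin k => ramD^[(i : ℕ)] (f j)) UHP ?_) hWnz
    · exact fun i j => ramD_iter_diff (hfd j) _
    · exact fun i j => ramD_iter_diff (hfd j) _
  have hF0 : F = 0 := by
    refine modZero (2 * k) F (r + 1) ?_ ?_ ?_ ?_
    · push_cast; omega
    · rw [UpperHalfPlane.mdifferentiable_iff]
      refine hRd.congr fun z hz => ?_
      simp only [hFdef, Function.comp]
      rw [UpperHalfPlane.ofComplex_apply_of_im_pos hz]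
    · intro γ
      ext z
      rw [ModularForm.SL_slash_apply]
      have hφ : DifferentiableOn ℂ (moeb γ) UHP := fun τ hτ =>
        (moeb_hasDerivAt γ ⟨τ, hτ⟩).differentiableAt.differentiableWithinAt
      have hm : Set.MapsTo (moeb γ) UHP UHP := by
        intro τ hτ
        rw [show τ = ((⟨τ, hτ⟩ : ℍ) : ℂ) from rfl, moeb_eq]
        exact (γ • (⟨τ, hτ⟩ : ℍ)).2
      have hA' : ∀ i, ∃ a : Fin k → ℂ, ∀ τ ∈ UHP, f i (moeb γ τ) = ∑ l, a l * f l τ := by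
        intro i
        obtain ⟨a, ha⟩ := (Submodule.mem_span_range_iff_exists_fun ℂ).mp (hmod γ i)
        refine ⟨a, fun τ hτ => ?_⟩
        have := congrFun ha ⟨τ, hτ⟩
        simp only [Finset.sum_apply, Pi.smul_apply, smul_eq_mul] at this
        exact this.symm
      choose A hA using hA'
      have hz : (z : ℂ) ∈ UHP := z.2
      obtain ⟨h1, h2⟩ := wronskian_transform hφ hm f hfd A hA hz
      rw [(moeb_hasDerivAt γ z).deriv] at h1 h2
      have hd := UpperHalfPlane.denom_ne_zero γ z
      have hW1 := hWnz z hz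
      have hW2 := hWnz _ (hm hz)
      simp only [hFdef, hR, ← moeb_eq]
      set P := ∏ i : Fin k, ((UpperHalfPlane.denom γ z ^ 2)⁻¹) ^ (i : ℕ) with hP
      have hPne : P ≠ 0 :=
        Finset.prod_ne_zero_iff.mpr fun i _ => pow_ne_zero _ (inv_ne_zero (pow_ne_zero _ hd))
      have hAne : (Matrix.of A).det ≠ 0 := by
        intro h0
        rw [h0, mul_zero] at h1
        exact mul_ne_zero hPne hW2 h1.symm
      have hx : UpperHalfPlane.denom γ z ^ (-(2 * (k : ℤ))) =
          ((UpperHalfPlane.denom γ z ^ 2)⁻¹) ^ k := by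
        rw [zpow_neg, inv_pow, ← pow_mul]
        norm_cast
      rw [hx, div_mul_eq_mul_div, div_eq_div_iff hW2 hW1]
      apply mul_left_cancel₀ (mul_ne_zero hPne hAne)
      linear_combination (P * (Matrix.of fun i j : Fin k =>
        (ramD^[(i : ℕ) + 1] (f j)) (moeb γ z)).det * ((UpperHalfPlane.denom γ z ^ 2)⁻¹) ^ k) * h1 -
        (P * (Matrix.of fun i j : Fin k => (ramD^[(i : ℕ)] (f j)) (moeb γ z)).det) * h2
    · obtain ⟨Φ, hΦ, hRΦ⟩ := ratio_form f h g hgdiff hg0 hmono hf r idx hidx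
      have hq : Filter.Tendsto (fun z : ℍ => qq z) atImInfty (nhds 0) := by
        have := UpperHalfPlane.qParam_tendsto_atImInfty zero_lt_one
        refine this.congr fun z => ?_
        simp [Function.Periodic.qParam, qq]
      have hb : (fun z : ℍ => Φ (qq z)) =O[atImInfty] (fun _ => (1 : ℝ)) :=
        (hΦ.tendsto.comp hq).isBigO_one ℝ
      have hF' : F = fun z : ℍ => qq z ^ (r + 1) * Φ (qq z) := by
        funext z; exact hRΦ z z.2
      rw [hF']
      have hqO : (fun z : ℍ => qq z ^ (r + 1)) =O[atImInfty]
          fun τ : ℍ => (Real.exp (-2 * Real.pi * τ.im)) ^ (r + 1) := by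
        refine Asymptotics.IsBigO.pow (Asymptotics.IsBigO.of_bound 1 ?_) _
        refine Filter.Eventually.of_forall fun z => ?_
        rw [norm_qq, Real.norm_of_nonneg (Real.exp_pos _).le, one_mul]
        exact le_rfl
      simpa using hqO.mul hb
  intro τ hτ
  have h1 := congrFun hF0 ⟨τ, hτ⟩
  have h2 : (Matrix.of fun i j : Fin k => (ramD^[(i : ℕ) + 1] (f j)) τ).det /
      (Matrix.of fun i j : Fin k => (ramD^[(i : ℕ)] (f j)) τ).det = 0 := h1
  exact (div_eq_zero_iff.mp h2).resolve_right (hWnz τ hτ)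

/-- If the Wronskian of derivatives vanishes, then `1` lies in `V`. -/
lemma one_mem {k : ℕ} (hk : 0 < k)
    (f : Fin k → ℂ → ℂ) (hfd : ∀ i, DifferentiableOn ℂ (f i) UHP)
    (hWnz : ∀ τ ∈ UHP,
      Matrix.det (Matrix.of fun i j : Fin k => (ramD^[(i : ℕ)] (f j)) τ) ≠ 0)
    (hW' : ∀ τ ∈ UHP, (Matrix.of fun i j : Fin k => (ramD^[(i : ℕ) + 1] (f j)) τ).det = 0) :
    ∃ c : Fin k → ℂ, ∀ τ ∈ UHP, ∑ j, c j * f j τ = 1 := by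
  set M : ℂ → Matrix (Fin k) (Fin k) ℂ := fun τ =>
    Matrix.of fun i j : Fin k => (ramD^[(i : ℕ)] (f j)) τ with hM
  set e0 : Fin k → ℂ := fun i => if (i : ℕ) = 0 then 1 else 0 with he0
  set c : ℂ → Fin k → ℂ := fun τ j => (M τ).cramer e0 j / (M τ).det with hc
  have hMc : ∀ τ ∈ UHP, Matrix.mulVec (M τ) (c τ) = e0 := by
    intro τ hτ
    have h1 : c τ = ((M τ).det)⁻¹ • (M τ).cramer e0 := by
      funext j; simp [hc, div_eq_inv_mul]
    rw [h1, Matrix.mulVec_smul, Matrix.mulVec_cramer, smul_smul,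
      inv_mul_cancel₀ (hWnz τ hτ), one_smul]
  have hrow : ∀ τ ∈ UHP, ∀ n < k, ∑ j, ramD^[n] (f j) τ * c τ j = if n = 0 then 1 else 0 := by
    intro τ hτ n hn
    exact congrFun (hMc τ hτ) ⟨n, hn⟩
  have hrow' : ∀ τ ∈ UHP, ∀ n < k, ∑ j, ramD^[n + 1] (f j) τ * c τ j = 0 := by
    intro τ hτ n hn
    obtain ⟨v, hv, hv0⟩ := Matrix.exists_mulVec_eq_zero_iff.mpr (hW' τ hτ)
    have hvrow : ∀ n < k, ∑ j, ramD^[n + 1] (f j) τ * v j = 0 := fun n hn =>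
      congrFun hv0 ⟨n, hn⟩
    set a := ∑ j, f j τ * v j with ha
    have hMv : Matrix.mulVec (M τ) v = a • e0 := by
      funext i
      rcases i with ⟨i, hi⟩
      cases i with
      | zero => simp [hM, he0, Matrix.mulVec, dotProduct, ha]
      | succ i =>
        have := hvrow i (by omega)
        simpa [hM, he0, Matrix.mulVec, dotProduct] using this
    have hinj : ∀ x y, Matrix.mulVec (M τ) x = Matrix.mulVec (M τ) y → x = y := by
      intro x y hxy
      exact Matrix.mulVec_injective_of_isUnit
        ((Matrix.isUnit_iff_isUnit_det _).mpr (isUnit_iff_ne_zero.mpr (hWnz τ hτ))) hxy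
    have hva : v = a • c τ := hinj _ _ (by rw [hMv, Matrix.mulVec_smul, hMc τ hτ])
    have ha0 : a ≠ 0 := by
      intro h0; rw [h0, zero_smul] at hva; exact hv hva
    have := hvrow n hn
    rw [hva] at this
    have h2 : a * ∑ j, ramD^[n + 1] (f j) τ * c τ j = 0 := by
      rw [← this, Finset.mul_sum]
      exact Finset.sum_congr rfl fun j _ => by simp; ring
    exact (mul_eq_zero.mp h2).resolve_left ha0
  have hcd : ∀ j, DifferentiableOn ℂ (fun τ => c τ j) UHP := by
    intro j
    refine DifferentiableOn.fun_div ?_ (det_differentiableOn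
      (fun i j : Fin k => ramD^[(i : ℕ)] (f j)) UHP
      (fun i j => ramD_iter_diff (hfd j) _)) hWnz
    simp only [Matrix.cramer_apply]
    have := det_differentiableOn
      (fun a b : Fin k => fun τ => (M τ).updateCol j e0 a b) UHP ?_
    · exact this
    · intro a b
      simp only [Matrix.updateCol_apply]
      split_ifs
      · exact differentiableOn_const _
      · exact ramD_iter_diff (hfd b) _
  have hcderiv : ∀ τ ∈ UHP, ∀ j, deriv (fun z => c z j) τ = 0 := by
    intro τ hτ
    have hz : Matrix.mulVec (M τ) (fun j => deriv (fun z => c z j) τ) = 0 := by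
      funext i
      have h1 : HasDerivAt (fun z => ∑ j, ramD^[(i : ℕ)] (f j) z * c z j)
          (∑ j, (deriv (ramD^[(i : ℕ)] (f j)) τ * c τ j +
            ramD^[(i : ℕ)] (f j) τ * deriv (fun z => c z j) τ)) τ :=
        HasDerivAt.fun_sum fun j _ =>
          (UHP_diffAt (ramD_iter_diff (hfd j) _) hτ).hasDerivAt.mul
            (UHP_diffAt (hcd j) hτ).hasDerivAt
      have h2 : HasDerivAt (fun z => ∑ j, ramD^[(i : ℕ)] (f j) z * c z j) 0 τ := by
        refine (hasDerivAt_const τ (if (i : ℕ) = 0 then (1 : ℂ) else 0)).congr_of_eventuallyEq ?_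
        filter_upwards [isOpen_UHP.mem_nhds hτ] with z hz
        exact hrow z hz i i.2
      have h3 := h1.unique h2
      rw [Finset.sum_add_distrib] at h3
      have h4 : ∑ j, deriv (ramD^[(i : ℕ)] (f j)) τ * c τ j = 0 := by
        have := hrow' τ hτ i i.2
        simp only [Function.iterate_succ_apply', ramD, mul_assoc] at this
        rw [← Finset.mul_sum] at this
        exact (mul_eq_zero.mp this).resolve_left
          (inv_ne_zero (by simp))
      rw [h4, zero_add] at h3
      exact h3
    have := Matrix.eq_zero_of_mulVec_eq_zero (hWnz τ hτ) hz
    intro j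
    exact congrFun this j
  have hI : (I : ℂ) ∈ UHP := by simp [UHP]
  have hconst : ∀ j, ∀ τ ∈ UHP, c τ j = c I j := by
    intro j τ hτ
    have hconv : Convex ℝ UHP := convex_halfSpace_im_gt 0
    exact isOpen_UHP.is_const_of_deriv_eq_zero hconv.isPreconnected (hcd j)
      (fun z hz => hcderiv z hz j) hτ hI
  refine ⟨c I, fun τ hτ => ?_⟩
  have := hrow τ hτ 0 hk
  simp only [Function.iterate_zero, id, if_true] at this
  rw [← this]
  refine Finset.sum_congr rfl fun j _ => ?_
  rw [hconst j τ hτ, mul_comm]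

lemma part_two {k : ℕ} (f : Fin k → ℂ → ℂ) (h : Fin k → ℚ) (g : Fin k → ℂ → ℂ)
    (hf : ∀ i, ∀ τ ∈ UHP, f i τ = ee (h i) τ * g i (qq τ))
    (hli : LinearIndependent ℂ fun i => UHP.restrict (f i))
    (c : Fin k → ℂ) (hc : ∀ τ ∈ UHP, ∑ j, c j * f j τ = 1)
    (j : Fin k) (hj : ¬ ∃ n : ℤ, h j = n) : c j = 0 := by
  have hshift : ∀ i, ∀ τ ∈ UHP, f i (τ + 1) = ee (h i) 1 * f i τ := by
    intro i τ hτ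
    have hτ1 : τ + 1 ∈ UHP := by simpa [UHP] using hτ
    have h1 : qq (τ + 1) = qq τ := by
      rw [qq, qq, mul_add, mul_one, Complex.exp_add, Complex.exp_two_pi_mul_I, mul_one]
    have h2 : ee (h i) (τ + 1) = ee (h i) 1 * ee (h i) τ := by
      rw [ee, ee, ee, ← Complex.exp_add]; congr 1; ring
    rw [hf i _ hτ1, hf i _ hτ, h1, h2, mul_assoc]
  have hz : ∑ i, (c i * (ee (h i) 1 - 1)) • UHP.restrict (f i) = 0 := by
    funext ⟨τ, hτ⟩
    have hτ1 : τ + 1 ∈ UHP := by simpa [UHP] using hτ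
    have e1 := hc τ hτ
    have e2 := hc _ hτ1
    have e3 : ∑ i, (c i * (ee (h i) 1 - 1)) * f i τ =
        ∑ i, c i * f i (τ + 1) - ∑ i, c i * f i τ := by
      rw [← Finset.sum_sub_distrib]
      refine Finset.sum_congr rfl fun i _ => ?_
      rw [hshift i τ hτ]; ring
    rw [e1, e2, sub_self] at e3
    simp only [Finset.sum_apply, Pi.smul_apply, smul_eq_mul]
    exact e3
  have h0 := Fintype.linearIndependent_iff.mp hli _ hz j
  refine (mul_eq_zero.mp h0).resolve_right fun h1 => hj ?_
  have h2 : ee (h j) 1 = 1 := sub_eq_zero.mp h1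
  rw [ee, Complex.exp_eq_one_iff] at h2
  obtain ⟨n, hn⟩ := h2
  refine ⟨n, ?_⟩
  have h3 : (h j : ℂ) = n := by
    have := Complex.two_pi_I_ne_zero
    apply mul_left_cancel₀ this
    rw [mul_one] at hn
    rw [hn]; ring
  exact_mod_cast h3

end Main

/-- let `V` be the `k`-dimensional `SL(2,ℤ)`-invariant space spanned by
`f_i(τ) = e^{2πi h_i τ} g_i(e^{2πiτ})`, `h₁ < ⋯ < h_k ∈ ℚ`, `g_i` holomorphic on the
unit disk with `g_i(0) ≠ 0`.  If (i) the Wronskian `W_V` is nowhere zero on `ℍ` and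
(ii) there are `r ≥ ⌊k/6⌋` and indices `i₀,…,i_r` with `h_{i_j} = j`, then the
Wronskian of the derivatives `W′_V` vanishes identically on `ℍ`; if moreover the
`i_j` are the only indices with `h_i ∈ ℤ`, then some nontrivial combination
`∑ λ_j f_{i_j}` is a nonzero constant `C` on `ℍ`. -/
theorem stmt_1 (k : ℕ) (hk : 0 < k)
    (f : Fin k → ℂ → ℂ) (h : Fin k → ℚ) (g : Fin k → ℂ → ℂ)
    (hgdiff : ∀ i, DifferentiableOn ℂ (g i) (Metric.ball 0 1))
    (hg0 : ∀ i, g i 0 ≠ 0)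
    (hmono : StrictMono h)
    (hf : ∀ i, ∀ τ ∈ UHP, f i τ =
      Complex.exp (2 * (Real.pi : ℂ) * I * (h i : ℂ) * τ) *
        g i (Complex.exp (2 * (Real.pi : ℂ) * I * τ)))
    (hli : LinearIndependent ℂ fun i => UHP.restrict (f i))
    (hmod : ∀ γ : Matrix.SpecialLinearGroup (Fin 2) ℤ, ∀ i : Fin k,
      UHP.restrict (fun τ =>
        f i (((((γ : Matrix (Fin 2) (Fin 2) ℤ) 0 0 : ℤ) : ℂ) * τ +
              (((γ : Matrix (Fin 2) (Fin 2) ℤ) 0 1 : ℤ) : ℂ)) /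
            ((((γ : Matrix (Fin 2) (Fin 2) ℤ) 1 0 : ℤ) : ℂ) * τ +
              (((γ : Matrix (Fin 2) (Fin 2) ℤ) 1 1 : ℤ) : ℂ)))) ∈
        Submodule.span ℂ (Set.range fun i => UHP.restrict (f i)))
    (hWnz : ∀ τ ∈ UHP,
      Matrix.det (Matrix.of fun i j : Fin k => (ramD^[(i : ℕ)] (f j)) τ) ≠ 0)
    (r : ℕ) (hr : k / 6 ≤ r)
    (idx : Fin (r + 1) → Fin k)
    (hidx : ∀ j : Fin (r + 1), h (idx j) = ((j : ℕ) : ℚ)) :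
    (∀ τ ∈ UHP,
      Matrix.det (Matrix.of fun i j : Fin k => (ramD^[(i : ℕ)] (ramD (f j))) τ) = 0) ∧
    ((∀ i : Fin k, (∃ n : ℤ, h i = (n : ℚ)) → ∃ j : Fin (r + 1), idx j = i) →
      ∃ (lam : Fin (r + 1) → ℂ) (C : ℂ), C ≠ 0 ∧
        ∀ τ ∈ UHP, ∑ j, lam j * f (idx j) τ = C) := by
  have hfd : ∀ i, DifferentiableOn ℂ (f i) UHP := fun i =>
    eeG_diff (h i) (hgdiff i) (hf i)
  have h1 := part_one f h g hgdiff hg0 hmono hf hmod hWnz r hr idx hidx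
  refine ⟨h1, fun honly => ?_⟩
  obtain ⟨c, hc⟩ := one_mem hk f hfd hWnz h1
  refine ⟨fun j => c (idx j), 1, one_ne_zero, fun τ hτ => ?_⟩
  rw [← hc τ hτ]
  have hinj : Function.Injective idx := by
    intro a b hab
    have := (hidx a).symm.trans ((congrArg h hab).trans (hidx b))
    exact Fin.ext (by exact_mod_cast this)
  rw [← Finset.sum_image (f := fun i => c i * f i τ) (s := Finset.univ) (g := idx)
    (fun a _ b _ hab => hinj hab)]
  refine Finset.sum_subset (Finset.subset_univ _) fun i _ hi => ?_
  rw [part_two f h g hf hli c hc i, zero_mul]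
  intro hn
  obtain ⟨j, rfl⟩ := honly i hn
  exact hi (Finset.mem_image_of_mem idx (Finset.mem_univ j))
end

section
/- For every τ in the upper half-plane ℍ: ch₁(−1/τ) = (2/√5)·(−sin(2π/5)·ch₁(τ) + sin(4π/5)·ch₂(τ)) and ch₂(−1/τ) = (2/√5)·(sin(4π/5)·ch₁(τ) + sin(2π/5)·ch₂(τ)). In particular, the two-dimensional space spanned by ch₁ and ch₂ is invariant under τ ↦ −1/τ. -/
open Complex

/-- The Rogers–Ramanujan character
`ch₁(τ) = e^{2πi(11/60)τ} ∏_{n≥0} 1/((1−q^{5n+2})(1−q^{5n+3}))`, `q = e^{2πiτ}`. -/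
noncomputable def chOne (τ : ℂ) : ℂ :=
  Complex.exp (2 * (Real.pi : ℂ) * I * (11 / 60) * τ) *
    ∏' n : ℕ, ((1 - Complex.exp (2 * (Real.pi : ℂ) * I * τ) ^ (5 * n + 2))⁻¹ *
      (1 - Complex.exp (2 * (Real.pi : ℂ) * I * τ) ^ (5 * n + 3))⁻¹)

/-- The Rogers–Ramanujan character
`ch₂(τ) = e^{−2πi(1/60)τ} ∏_{n≥0} 1/((1−q^{5n+1})(1−q^{5n+4}))`, `q = e^{2πiτ}`. -/
noncomputable def chTwo (τ : ℂ) : ℂ :=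
  Complex.exp (-(2 * (Real.pi : ℂ) * I * (1 / 60) * τ)) *
    ∏' n : ℕ, ((1 - Complex.exp (2 * (Real.pi : ℂ) * I * τ) ^ (5 * n + 1))⁻¹ *
      (1 - Complex.exp (2 * (Real.pi : ℂ) * I * τ) ^ (5 * n + 4))⁻¹)

noncomputable section
def qP (Q : ℂ) (m : ℕ) : ℂ := ∏ k ∈ Finset.range m, (1 - Q ^ (k + 1))
def qR (Q : ℂ) (m : ℤ) : ℂ := if m < 0 then 0 else (qP Q m.toNat)⁻¹
end

lemma one_sub_pow_ne {Q : ℂ} (hQ : ‖Q‖ < 1) (k : ℕ) : 1 - Q ^ (k + 1) ≠ 0 := by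
  intro h
  have h1 : Q ^ (k+1) = 1 := (sub_eq_zero.mp h).symm
  have h2 : ‖Q‖ ^ (k+1) = 1 := by rw [← norm_pow, h1, norm_one]
  have h3 := pow_lt_one₀ (norm_nonneg Q) hQ (Nat.succ_ne_zero k)
  exact absurd h2 h3.ne

lemma qP_ne {Q : ℂ} (hQ : ‖Q‖ < 1) (m : ℕ) : qP Q m ≠ 0 :=
  Finset.prod_ne_zero_iff.mpr fun k _ => one_sub_pow_ne hQ k

lemma qR_rec {Q : ℂ} (hQ : ‖Q‖ < 1) (m : ℤ) : qR Q (m - 1) = (1 - Q ^ m) * qR Q m := by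
  unfold qR
  rcases lt_trichotomy m 0 with h | h | h
  · rw [if_pos h, if_pos (by omega), mul_zero]
  · subst h; simp
  · obtain ⟨k, rfl⟩ : ∃ k : ℕ, m = k + 1 := ⟨(m-1).toNat, by omega⟩
    rw [if_neg (by omega), if_neg (by omega)]
    have e1 : ((k:ℤ) + 1 - 1).toNat = k := by omega
    have e2 : ((k:ℤ) + 1).toNat = k + 1 := by omega
    rw [e1, e2]
    have h1 := one_sub_pow_ne hQ k
    have h2 := qP_ne hQ k
    have h3 : qP Q (k+1) = qP Q k * (1 - Q ^ (k+1)) := by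
      unfold qP; rw [Finset.prod_range_succ]
    have h4 : Q ^ ((k:ℤ) + 1) = Q ^ (k+1) := by norm_cast
    rw [h3, h4]
    field_simp

lemma finite_jtp {Q x : ℂ} (hQ : ‖Q‖ < 1) (hQ0 : Q ≠ 0) (hx : x ≠ 0) (t : ℤ → ℂ)
    (ht0 : t 0 = 1) (ht : ∀ j, t (j + 1) = -x * Q ^ j * t j) (M : ℕ) :
    HasSum (fun j : ℤ => qP Q (2 * M) * qR Q (M + j) * qR Q (M - j) * t j)
      (∏ k ∈ Finset.range M, (1 - x * Q ^ k) * (1 - Q ^ (k + 1) / x)) := by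
  induction M with
  | zero =>
    have := hasSum_single (f := fun j : ℤ => qP Q (2 * (0:ℕ)) * qR Q ((0:ℕ) + j) * qR Q ((0:ℕ) - j) * t j) 0 ?_
    · simpa [qP, qR, ht0] using this
    · intro j hj
      rcases lt_or_gt_of_ne hj with h | h
      · simp [qR, h]
      · simp [qR, h]
  | succ M ih =>
    rw [Finset.prod_range_succ]
    have h1 := ih.mul_left (1 + Q ^ (2 * M + 1))
    have h2 := ((Equiv.subRight (1:ℤ)).hasSum_iff.mpr ih).mul_left (-x * Q ^ M)
    have h3 := ((Equiv.addRight (1:ℤ)).hasSum_iff.mpr ih).mul_left (-Q ^ (M + 1) / x)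
    convert! (h1.add h2).add h3 using 1
    · funext j
      simp only [Function.comp_apply, Equiv.subRight_apply, Equiv.coe_addRight]
      set T := t (j - 1) with hT
      have e1 : t j = -x * Q ^ (j - 1) * T := by rw [hT, ← ht]; simp
      have e2 : t (j + 1) = -x * Q ^ j * (-x * Q ^ (j - 1) * T) := by rw [ht, e1]
      rw [e2, e1]
      have r1 := qR_rec hQ (M + 1 + j)
      have r2 := qR_rec hQ (M + 1 - j)
      have r3 := qR_rec hQ (M + j)
      have r4 := qR_rec hQ (M - j)
      have p : qP Q (2 * (M + 1)) = qP Q (2 * M) * (1 - Q ^ (2 * M + 1)) * (1 - Q ^ (2 * M + 2)) := by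
        unfold qP; rw [show 2 * (M + 1) = 2 * M + 1 + 1 by ring, Finset.prod_range_succ, Finset.prod_range_succ]
      rw [show (M : ℤ) + 1 + j - 1 = M + j by ring] at r1
      rw [show (M : ℤ) + 1 - j - 1 = M - j by ring] at r2
      push_cast
      rw [show (M : ℤ) + (j - 1) = M + j - 1 by ring, show (M : ℤ) - (j - 1) = M + 1 - j by ring,
        show (M : ℤ) + (j + 1) = M + 1 + j by ring, show (M : ℤ) - (j + 1) = M - j - 1 by ring,
        r3, r4, r1, r2, p]
      generalize qR Q (M + 1 + j) = r
      generalize qR Q (M + 1 - j) = s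
      generalize qP Q (2 * M) = P
      have z1 : Q ^ ((M:ℤ) + 1 + j) = Q ^ M * Q * Q ^ j := by
        rw [zpow_add₀ hQ0, zpow_add₀ hQ0]; simp
      have z2 : Q ^ ((M:ℤ) + 1 - j) = Q ^ M * Q / Q ^ j := by
        rw [zpow_sub₀ hQ0, zpow_add₀ hQ0]; simp
      have z3 : Q ^ ((M:ℤ) + j) = Q ^ M * Q ^ j := by
        rw [zpow_add₀ hQ0]; simp
      have z4 : Q ^ ((M:ℤ) - j) = Q ^ M / Q ^ j := by
        rw [zpow_sub₀ hQ0]; simp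
      have z5 : Q ^ (j - 1) = Q ^ j / Q := by
        rw [zpow_sub₀ hQ0]; simp
      have z6 : Q ^ (2 * M + 1) = Q ^ M * Q ^ M * Q := by ring
      have z7 : Q ^ (2 * M + 2) = Q ^ M * Q ^ M * Q * Q := by ring
      have z8 : Q ^ (M + 1) = Q ^ M * Q := by ring
      rw [z1, z2, z3, z4, z5, z6, z7, z8]
      have hJ : Q ^ j ≠ 0 := zpow_ne_zero _ hQ0
      generalize Q ^ j = J at *
      generalize Q ^ M = N at *
      field_simp
      ring
    · field_simp
      ring

open Filter Topology in
lemma jtp {Q x : ℂ} (hQ : ‖Q‖ < 1) (hQ0 : Q ≠ 0) (hx : x ≠ 0) (t : ℤ → ℂ)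
    (ht0 : t 0 = 1) (ht : ∀ j, t (j + 1) = -x * Q ^ j * t j) (hs : Summable t) {P A B : ℂ}
    (hP : HasProd (fun k : ℕ => 1 - Q ^ (k + 1)) P) (hP0 : P ≠ 0)
    (hA : HasProd (fun k : ℕ => 1 - x * Q ^ k) A)
    (hB : HasProd (fun k : ℕ => 1 - Q ^ (k + 1) / x) B) :
    A * B * P = ∑' j, t j := by
  have hPt : Tendsto (qP Q) atTop (𝓝 P) := hP.tendsto_prod_nat
  have hPi : Tendsto (fun m => (qP Q m)⁻¹) atTop (𝓝 P⁻¹) := hPt.inv₀ hP0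
  obtain ⟨C1, hC1⟩ := hPt.norm.bddAbove_range
  obtain ⟨C2, hC2⟩ := hPi.norm.bddAbove_range
  have hC1' : ∀ m, ‖qP Q m‖ ≤ C1 := fun m => hC1 ⟨m, rfl⟩
  have hC2' : ∀ m, ‖(qP Q m)⁻¹‖ ≤ C2 := fun m => hC2 ⟨m, rfl⟩
  have hC10 : 0 ≤ C1 := (norm_nonneg _).trans (hC1' 0)
  have hC20 : 0 ≤ C2 := (norm_nonneg _).trans (hC2' 0)
  have hR : ∀ m, ‖qR Q m‖ ≤ C2 := by
    intro m; unfold qR; split_ifs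
    · simpa using hC20
    · exact hC2' _
  have hRt : Tendsto (qR Q) atTop (𝓝 P⁻¹) := by
    have h1 : Tendsto (fun m : ℤ => (qP Q m.toNat)⁻¹) atTop (𝓝 P⁻¹) := by
      refine hPi.comp ?_
      exact tendsto_atTop.mpr fun b => (eventually_ge_atTop (b:ℤ)).mono fun m hm => by omega
    refine h1.congr' ?_
    filter_upwards [eventually_ge_atTop (0:ℤ)] with m hm
    rw [qR, if_neg (by omega)]
  have hlim : Tendsto (fun M : ℕ => ∑' j : ℤ, qP Q (2 * M) * qR Q (M + j) * qR Q (M - j) * t j) atTop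
      (𝓝 (∑' j : ℤ, P * P⁻¹ * P⁻¹ * t j)) := by
    refine tendsto_tsum_of_dominated_convergence (bound := fun j => C1 * C2 * C2 * ‖t j‖)
      (hs.norm.mul_left _) ?_ ?_
    · intro j
      refine Tendsto.mul_const _ (Tendsto.mul (Tendsto.mul ?_ ?_) ?_)
      · exact hPt.comp (tendsto_id.const_mul_atTop' (by norm_num))
      · exact hRt.comp (tendsto_atTop_add_const_right _ _ tendsto_natCast_atTop_atTop)
      · simp only [sub_eq_add_neg]
        exact hRt.comp (tendsto_atTop_add_const_right _ _ tendsto_natCast_atTop_atTop)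
    · refine Eventually.of_forall fun M j => ?_
      rw [norm_mul, norm_mul, norm_mul]
      have := hC1' (2 * M)
      have := hR (M + j)
      have := hR (M - j)
      gcongr
  have hlim2 : Tendsto (fun M : ℕ => ∑' j : ℤ, qP Q (2 * M) * qR Q (M + j) * qR Q (M - j) * t j) atTop
      (𝓝 (A * B)) := by
    refine (hA.mul hB).tendsto_prod_nat.congr fun M => ?_
    exact (finite_jtp hQ hQ0 hx t ht0 ht M).tsum_eq.symm
  have := tendsto_nhds_unique hlim2 hlim
  rw [this, tsum_mul_left]
  field_simp

lemma pow_summ {q : ℂ} (hq : ‖q‖ < 1) (r : ℕ) : Summable fun n : ℕ => ‖-(q ^ (5 * n + r))‖ := by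
  have h5 : ‖q ^ 5‖ < 1 := by rw [norm_pow]; exact pow_lt_one₀ (norm_nonneg _) hq (by norm_num)
  have := (summable_geometric_of_lt_one (norm_nonneg _) h5).mul_right (‖q‖ ^ r)
  refine this.congr fun n => ?_
  rw [norm_neg, norm_pow, norm_pow, pow_add, pow_mul]

lemma pow_mult {q : ℂ} (hq : ‖q‖ < 1) (r : ℕ) : Multipliable fun n : ℕ => 1 - q ^ (5 * n + r) := by
  simpa [sub_eq_add_neg] using! multipliable_one_add_of_summable (pow_summ hq r)

lemma pow_prod_ne {q : ℂ} (hq : ‖q‖ < 1) (r : ℕ) (hr : 0 < r) : ∏' n : ℕ, (1 - q ^ (5 * n + r)) ≠ 0 := by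
  have := tprod_one_add_ne_zero_of_summable (f := fun n : ℕ => -(q ^ (5 * n + r))) ?_ (pow_summ hq r)
  · simpa [sub_eq_add_neg] using! this
  · intro n
    have := one_sub_pow_ne hq (5 * n + r - 1)
    rw [show 5 * n + r - 1 + 1 = 5 * n + r by omega] at this
    simpa [sub_eq_add_neg] using! this

lemma inv_prod {q : ℂ} (hq : ‖q‖ < 1) (r s : ℕ) (hr : 0 < r) (hs : 0 < s) :
    ∏' n : ℕ, ((1 - q ^ (5 * n + r))⁻¹ * (1 - q ^ (5 * n + s))⁻¹) =
    (∏' n : ℕ, (1 - q ^ (5 * n + r)))⁻¹ * (∏' n : ℕ, (1 - q ^ (5 * n + s)))⁻¹ := by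
  have h : ∀ r, 0 < r → HasProd (fun n : ℕ => (1 - q ^ (5 * n + r))⁻¹) (∏' n : ℕ, (1 - q ^ (5 * n + r)))⁻¹ := by
    intro r hr
    have := (pow_mult hq r).hasProd.inv₀ (pow_prod_ne hq r hr)
    simpa using! this
  exact ((h r hr).mul (h s hs)).tprod_eq

lemma eta_prod {q : ℂ} (hq : ‖q‖ < 1) : ∏' n : ℕ, (1 - q ^ (n + 1)) =
    (∏' n : ℕ, (1 - q ^ (5 * n + 1))) * (∏' n : ℕ, (1 - q ^ (5 * n + 2))) *
    (∏' n : ℕ, (1 - q ^ (5 * n + 3))) * (∏' n : ℕ, (1 - q ^ (5 * n + 4))) *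
    (∏' n : ℕ, (1 - q ^ (5 * n + 5))) := by
  have hm : Multipliable fun n : ℕ => 1 - q ^ (n + 1) := ModularForm.multipliable_one_sub_pow hq
  have h1 := (Nat.divModEquiv 5).symm.hasProd_iff.mpr hm.hasProd
  have h2 := h1.prod_fiberwise (g := fun n : ℕ => ∏ r : Fin 5, (1 - q ^ (n * 5 + (r : ℕ) + 1)))
    (fun b => by convert! hasProd_fintype _ using 1)
  have h3 := ((((pow_mult hq 1).hasProd.mul (pow_mult hq 2).hasProd).mul (pow_mult hq 3).hasProd).mul
    (pow_mult hq 4).hasProd).mul (pow_mult hq 5).hasProd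
  refine h2.unique ?_
  convert! h3 using 1
  funext n
  simp [Fin.prod_univ_five, mul_comm n 5, add_assoc]

noncomputable def thS (b τ : ℂ) : ℂ :=
  ∑' n : ℤ, cexp (Real.pi * I * n + Real.pi * I * τ / 5 * (5 * n + b) ^ 2)

lemma thS_eq_theta (b τ : ℂ) : thS b τ =
    cexp (Real.pi * I * τ * b ^ 2 / 5) * jacobiTheta₂ (1 / 2 + b * τ) (5 * τ) := by
  rw [thS, jacobiTheta₂, ← tsum_mul_left]
  refine tsum_congr fun n => ?_
  rw [jacobiTheta₂_term, ← Complex.exp_add]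
  congr 1
  ring

lemma cexp_pi_neg (k : ℤ) : cexp (Real.pi * I * ((-k : ℤ) : ℂ)) = cexp (Real.pi * I * k) := by
  rw [Complex.exp_eq_exp_iff_exists_int]
  exact ⟨-k, by push_cast; ring⟩

lemma thS_neg (b τ : ℂ) : thS (-b) τ = thS b τ := by
  rw [thS, ← (Equiv.neg ℤ).tsum_eq, thS]
  refine tsum_congr fun n => ?_
  rw [Complex.exp_add, Complex.exp_add, Equiv.neg_apply, cexp_pi_neg]
  congr 2
  push_cast
  ring

lemma thS_refl (b τ : ℂ) : thS (5 - b) τ = - thS b τ := by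
  rw [thS, ← (Equiv.subLeft (-1 : ℤ)).tsum_eq, thS, ← tsum_neg]
  refine tsum_congr fun n => ?_
  rw [Complex.exp_add, Complex.exp_add, Equiv.subLeft_apply]
  have h : cexp (Real.pi * I * ((-1 - n : ℤ) : ℂ)) = - cexp (Real.pi * I * n) := by
    rw [← cexp_pi_neg n, ← neg_one_mul (cexp _), ← Complex.exp_pi_mul_I, ← Complex.exp_add,
      Complex.exp_eq_exp_iff_exists_int]
    exact ⟨-1, by push_cast; ring⟩
  rw [h, neg_mul]
  congr 3
  push_cast
  ring

lemma thS_summable (b : ℂ) {τ : ℂ} (hτ : 0 < τ.im) :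
    Summable fun n : ℤ => cexp (Real.pi * I * n + Real.pi * I * τ / 5 * (5 * n + b) ^ 2) := by
  have h := ((summable_jacobiTheta₂_term_iff (1 / 2 + b * τ) (5 * τ)).mpr (by simpa using hτ)).mul_left
    (cexp (Real.pi * I * τ * b ^ 2 / 5))
  refine h.congr fun n => ?_
  rw [jacobiTheta₂_term, ← Complex.exp_add]
  congr 1
  ring

lemma thS_trans (b : ℂ) {τ : ℂ} (hτ : 0 < τ.im) (l : ℤ) (hb : b = 1 / 2 + l) :
    thS b (-1 / τ) = 1 / (-I * (5 * (-1 / τ))) ^ (1 / 2 : ℂ) *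
      ∑ r : Fin 5, cexp (2 * Real.pi * I * (b / 5) * (((r : ℕ) : ℂ) - 1 / 2)) *
        thS (((r : ℕ) : ℂ) - 1 / 2) τ := by
  have hτ0 : τ ≠ 0 := by rintro rfl; simp at hτ
  rw [thS_eq_theta, jacobiTheta₂_functional_equation, mul_assoc (1 / _), mul_left_comm]
  congr 1
  rw [← mul_assoc, ← Complex.exp_add]
  have e1 : (1 / 2 + b * (-1 / τ)) / (5 * (-1 / τ)) = b / 5 - τ / 10 := by field_simp; ring
  have e2 : -1 / (5 * (-1 / τ)) = τ / 5 := by field_simp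
  rw [e1, e2]
  have hs := ((summable_jacobiTheta₂_term_iff (b / 5 - τ / 10) (τ / 5)).mpr
    (by simpa using hτ)).hasSum.mul_left (cexp (Real.pi * I * (-1 / τ) * b ^ 2 / 5 +
      -Real.pi * I * (1 / 2 + b * (-1 / τ)) ^ 2 / (5 * (-1 / τ))))
  have hs' := (Int.divModEquiv 5).symm.hasSum_iff.mpr hs
  have hs2 := hs'.prod_fiberwise (fun b => hasSum_fintype _)
  refine hs2.unique ?_
  have h3 : HasSum (fun k : ℤ => ∑ r : Fin 5, cexp (2 * Real.pi * I * (b / 5) * (((r : ℕ) : ℂ) - 1 / 2)) *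
      cexp (Real.pi * I * k + Real.pi * I * τ / 5 * (5 * k + (((r : ℕ) : ℂ) - 1 / 2)) ^ 2))
      (∑ r : Fin 5, cexp (2 * Real.pi * I * (b / 5) * (((r : ℕ) : ℂ) - 1 / 2)) *
        thS (((r : ℕ) : ℂ) - 1 / 2) τ) :=
    hasSum_sum fun r _ => (thS_summable _ hτ).hasSum.mul_left _
  convert! h3 using 1
  funext k
  refine Finset.sum_congr rfl fun r _ => ?_
  simp only [Function.comp_apply, Int.divModEquiv_symm_apply, jacobiTheta₂_term]
  rw [← Complex.exp_add, ← Complex.exp_add, Complex.exp_eq_exp_iff_exists_int]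
  refine ⟨k * l, ?_⟩
  subst hb
  push_cast
  field_simp
  ring

lemma sqrt_fact {τ : ℂ} (hτ : 0 < τ.im) :
    (sqrt I)⁻¹ * sqrt τ = (-I * τ) ^ (1 / 2 : ℂ) := by
  have hτ0 : τ ≠ 0 := by rintro rfl; simp at hτ
  have hw : -I * τ ≠ 0 := by simp [hτ0]
  have hre : 0 < (-I * τ).re := by simpa using hτ
  have h1 : |(-I * τ).arg| < Real.pi / 2 := Complex.abs_arg_lt_pi_div_two_iff.mpr (Or.inl hre)
  have h2 : log (I * (-I * τ)) = log I + log (-I * τ) := by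
    apply Complex.log_mul I_ne_zero hw
    rw [arg_I]
    have := abs_lt.mp h1
    constructor <;> linarith [Real.pi_pos]
  have h3 : I * (-I * τ) = τ := by rw [← mul_assoc]; simp
  rw [h3] at h2
  rw [Complex.sqrt, Complex.sqrt, cpow_def_of_ne_zero I_ne_zero, cpow_def_of_ne_zero hτ0,
    cpow_def_of_ne_zero hw, h2, ← Complex.exp_neg, ← Complex.exp_add]
  congr 1
  ring

lemma sqrt5_fact {τ : ℂ} (hτ : 0 < τ.im) :
    1 / (-I * (5 * (-1 / τ))) ^ (1 / 2 : ℂ) = (-I * τ) ^ (1 / 2 : ℂ) * ((1 / Real.sqrt 5 : ℝ) : ℂ) := by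
  have hτ0 : τ ≠ 0 := by rintro rfl; simp at hτ
  have hw : -I * τ ≠ 0 := by simp [hτ0]
  have hre : 0 < (-I * τ).re := by simpa using hτ
  have h1 : |(-I * τ).arg| < Real.pi / 2 := Complex.abs_arg_lt_pi_div_two_iff.mpr (Or.inl hre)
  have e : -I * (5 * (-1 / τ)) = ((5 : ℝ) : ℂ) * (-I * τ)⁻¹ := by
    push_cast; field_simp; simp
  have hs : ((Real.sqrt 5 : ℝ) : ℂ) = ((5 : ℝ) : ℂ) ^ (1 / 2 : ℂ) := by
    rw [Real.sqrt_eq_rpow, Complex.ofReal_cpow (by norm_num)]; norm_num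
  have harg : (-I * τ).arg ≠ Real.pi := by
    have := abs_lt.mp h1
    intro h; linarith [Real.pi_pos]
  have h5 : ((5 : ℝ) : ℂ) ≠ 0 := by norm_num
  have hinv : (-I * τ)⁻¹ ≠ 0 := inv_ne_zero hw
  rw [e, ofReal_div, hs, cpow_def_of_ne_zero (mul_ne_zero h5 hinv), Complex.log_ofReal_mul (by norm_num) hinv,
    Complex.log_inv _ harg, cpow_def_of_ne_zero hw, cpow_def_of_ne_zero h5, Complex.ofReal_log (by norm_num),
    ofReal_one, one_div, one_div, one_div, ← Complex.exp_neg, ← Complex.exp_neg, ← Complex.exp_add]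
  congr 1
  ring

lemma eta_trans {τ : ℂ} (hτ : 0 < τ.im) :
    ModularForm.eta (-1 / τ) = (-I * τ) ^ (1 / 2 : ℂ) * ModularForm.eta τ := by
  have := ModularForm.eta_comp_eq_csqrt_I_inv (x := τ) hτ
  simp only [Function.comp_apply, Pi.smul_apply, Pi.mul_apply, smul_eq_mul] at this
  rw [this, ← mul_assoc, sqrt_fact hτ]

lemma jtp_theta {q τ : ℂ} (hτ : 0 < τ.im) (hqd : q = cexp (2 * Real.pi * I * τ)) (hq : ‖q‖ < 1) (u v : ℕ) (huv : u + v = 5) :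
    (∏' n : ℕ, (1 - q ^ (5 * n + u))) * (∏' n : ℕ, (1 - q ^ (5 * n + v))) *
    (∏' n : ℕ, (1 - q ^ (5 * n + 5))) = jacobiTheta₂ (1 / 2 + (u - 5 / 2) * τ) (5 * τ) := by
  have hq0 : q ≠ 0 := hqd ▸ Complex.exp_ne_zero _
  have h5 : ‖q ^ 5‖ < 1 := by rw [norm_pow]; exact pow_lt_one₀ (norm_nonneg _) hq (by norm_num)
  rw [jacobiTheta₂]
  apply jtp h5 (pow_ne_zero 5 hq0) (x := q ^ u) (pow_ne_zero u hq0)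
  · simp [jacobiTheta₂_term]
  · intro j
    rw [← neg_one_mul, ← Complex.exp_pi_mul_I, hqd, ← Complex.exp_nat_mul, ← Complex.exp_nat_mul,
      ← Complex.exp_int_mul]
    simp only [jacobiTheta₂_term, ← Complex.exp_add]
    congr 1
    push_cast
    ring
  · exact (summable_jacobiTheta₂_term_iff _ _).mpr (by simpa using hτ)
  · convert! (pow_mult hq 5).hasProd using 1
    funext n
    rw [← pow_mul]; ring
  · exact pow_prod_ne hq 5 (by norm_num)
  · convert! (pow_mult hq u).hasProd using 1
    funext n
    rw [← pow_mul, ← pow_add]; ring_nf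
  · convert! (pow_mult hq v).hasProd using 1
    funext n
    have : (q ^ 5) ^ (n + 1) = q ^ (5 * n + v) * q ^ u := by
      rw [← pow_mul, ← pow_add]
      congr 1
      omega
    rw [this, mul_div_cancel_right₀ _ (pow_ne_zero u hq0)]

lemma norm_q_lt {τ : ℂ} (hτ : 0 < τ.im) : ‖cexp (2 * Real.pi * I * τ)‖ < 1 :=
  UpperHalfPlane.norm_exp_two_pi_I_lt_one ⟨τ, hτ⟩

lemma chOne_eta {τ : ℂ} (hτ : 0 < τ.im) : chOne τ * ModularForm.eta τ = thS (3 / 2) τ := by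
  have hq := norm_q_lt hτ
  have h := jtp_theta hτ rfl hq 4 1 rfl
  rw [chOne, ModularForm.eta, inv_prod hq 2 3 (by norm_num) (by norm_num), thS_eq_theta]
  simp_rw [ModularForm.eta_q_eq_pow]
  rw [eta_prod hq]
  have h2 := pow_prod_ne hq 2 (by norm_num)
  have h3 := pow_prod_ne hq 3 (by norm_num)
  have e : (1 / 2 + (((4 : ℕ) : ℂ) - 5 / 2) * τ) = 1 / 2 + 3 / 2 * τ := by push_cast; ring
  have e2 : cexp (Real.pi * I * τ * (3 / 2) ^ 2 / 5) =
      cexp (2 * Real.pi * I * (11 / 60) * τ) * Function.Periodic.qParam 24 τ := by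
    rw [Function.Periodic.qParam, ← Complex.exp_add]; congr 1; push_cast; ring
  rw [e] at h
  rw [← h, e2]
  field_simp

lemma chTwo_eta {τ : ℂ} (hτ : 0 < τ.im) : chTwo τ * ModularForm.eta τ = thS (1 / 2) τ := by
  have hq := norm_q_lt hτ
  have h := jtp_theta hτ rfl hq 3 2 rfl
  rw [chTwo, ModularForm.eta, inv_prod hq 1 4 (by norm_num) (by norm_num), thS_eq_theta]
  simp_rw [ModularForm.eta_q_eq_pow]
  rw [eta_prod hq]
  have h2 := pow_prod_ne hq 1 (by norm_num)
  have h3 := pow_prod_ne hq 4 (by norm_num)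
  have e : (1 / 2 + (((3 : ℕ) : ℂ) - 5 / 2) * τ) = 1 / 2 + 1 / 2 * τ := by push_cast; ring
  have e2 : cexp (Real.pi * I * τ * (1 / 2) ^ 2 / 5) =
      cexp (-(2 * Real.pi * I * (1 / 60) * τ)) * Function.Periodic.qParam 24 τ := by
    rw [Function.Periodic.qParam, ← Complex.exp_add]; congr 1; push_cast; ring
  rw [e] at h
  rw [← h, e2]
  field_simp

lemma five_sum (b : ℂ) (τ : ℂ) :
    ∑ r : Fin 5, cexp (2 * Real.pi * I * (b / 5) * (((r : ℕ) : ℂ) - 1 / 2)) *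
        thS (((r : ℕ) : ℂ) - 1 / 2) τ =
    2 * Complex.cos (Real.pi * b / 5) * thS (1 / 2) τ +
    (cexp (3 * Real.pi * b / 5 * I) - cexp (7 * Real.pi * b / 5 * I)) * thS (3 / 2) τ := by
  have h0 : thS (-(1 / 2)) τ = thS (1 / 2) τ := thS_neg _ _
  have h5 : thS (5 / 2) τ = 0 := by
    have := thS_refl (5 / 2) τ
    rw [show (5 : ℂ) - 5 / 2 = 5 / 2 by norm_num] at this
    exact self_eq_neg.mp this
  have h7 : thS (7 / 2) τ = - thS (3 / 2) τ := by
    rw [← thS_refl]; norm_num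
  simp only [Fin.sum_univ_five]
  norm_num [-one_div]
  rw [Complex.two_cos]
  rw [h0, h5, h7]
  ring_nf

lemma cos_a : Complex.cos (Real.pi * (1 / 2) / 5) = (Real.sin (2 * Real.pi / 5) : ℝ) := by
  rw [← Real.cos_pi_div_two_sub, ofReal_cos]; congr 1; push_cast; ring
lemma cos_b : Complex.cos (Real.pi * (3 / 2) / 5) = (Real.sin (4 * Real.pi / 5) : ℝ) := by
  rw [← Real.sin_pi_sub, ← Real.cos_pi_div_two_sub, ofReal_cos]; congr 1; push_cast; ring
lemma exp_a : cexp (3 * Real.pi * (1 / 2) / 5 * I) - cexp (7 * Real.pi * (1 / 2) / 5 * I) =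
    2 * (Real.sin (4 * Real.pi / 5) : ℝ) := by
  rw [← cos_b, Complex.two_cos, sub_eq_add_neg, ← neg_one_mul, ← Complex.exp_pi_mul_I, ← Complex.exp_add]
  congr 1
  · congr 1; ring
  · rw [Complex.exp_eq_exp_iff_exists_int]
    exact ⟨1, by push_cast; ring⟩
lemma exp_b : cexp (3 * Real.pi * (3 / 2) / 5 * I) - cexp (7 * Real.pi * (3 / 2) / 5 * I) =
    2 * -(Real.sin (2 * Real.pi / 5) : ℝ) := by
  rw [← cos_a, mul_neg, Complex.two_cos, neg_add, sub_eq_add_neg]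
  rw [← neg_one_mul (cexp (_ / 5 * I)), ← neg_one_mul (cexp (Real.pi * (1 / 2) / 5 * I)),
    ← neg_one_mul (cexp (-(Real.pi * (1 / 2) / 5) * I)), ← Complex.exp_pi_mul_I, ← Complex.exp_add,
    ← Complex.exp_add, ← Complex.exp_add, add_comm]
  congr 1
  · rw [Complex.exp_eq_exp_iff_exists_int]
    exact ⟨1, by push_cast; ring⟩
  · rw [Complex.exp_eq_exp_iff_exists_int]
    exact ⟨0, by push_cast; ring⟩

/-- for every `τ ∈ ℍ`,
`ch₁(−1/τ) = (2/√5)(−sin(2π/5)·ch₁(τ) + sin(4π/5)·ch₂(τ))` and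
`ch₂(−1/τ) = (2/√5)(sin(4π/5)·ch₁(τ) + sin(2π/5)·ch₂(τ))`;
in particular the span of `ch₁, ch₂` (as functions on `ℍ`) is invariant under
`τ ↦ −1/τ`. -/
theorem stmt_6 :
    (∀ τ : ℂ, 0 < τ.im →
      chOne (-1 / τ) = (2 / Real.sqrt 5 : ℝ) *
        (-(Real.sin (2 * Real.pi / 5) : ℝ) * chOne τ +
          (Real.sin (4 * Real.pi / 5) : ℝ) * chTwo τ) ∧
      chTwo (-1 / τ) = (2 / Real.sqrt 5 : ℝ) *
        ((Real.sin (4 * Real.pi / 5) : ℝ) * chOne τ +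
          (Real.sin (2 * Real.pi / 5) : ℝ) * chTwo τ)) ∧
    (UHP.restrict (fun τ => chOne (-1 / τ)) ∈
      Submodule.span ℂ {UHP.restrict chOne, UHP.restrict chTwo}) ∧
    (UHP.restrict (fun τ => chTwo (-1 / τ)) ∈
      Submodule.span ℂ {UHP.restrict chOne, UHP.restrict chTwo}) := by
  have main : ∀ τ : ℂ, 0 < τ.im →
      chOne (-1 / τ) = (2 / Real.sqrt 5 : ℝ) *
        (-(Real.sin (2 * Real.pi / 5) : ℝ) * chOne τ +
          (Real.sin (4 * Real.pi / 5) : ℝ) * chTwo τ) ∧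
      chTwo (-1 / τ) = (2 / Real.sqrt 5 : ℝ) *
        ((Real.sin (4 * Real.pi / 5) : ℝ) * chOne τ +
          (Real.sin (2 * Real.pi / 5) : ℝ) * chTwo τ) := by
    intro τ hτ
    have hτ0 : τ ≠ 0 := by rintro rfl; simp at hτ
    have hτ' : 0 < (-1 / τ).im := by
      rw [neg_div, one_div, neg_im, inv_im, neg_div, neg_neg]
      exact div_pos hτ (normSq_pos.mpr hτ0)
    have he := ModularForm.eta_ne_zero (z := τ) hτ
    have he' := ModularForm.eta_ne_zero (z := -1 / τ) hτ'
    have h1 := chOne_eta hτ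
    have h2 := chTwo_eta hτ
    have h1' := chOne_eta hτ'
    have h2' := chTwo_eta hτ'
    have hw : (-I * τ) ^ (1 / 2 : ℂ) ≠ 0 := by
      intro h; exact he' (by rw [eta_trans hτ, h, zero_mul])
    rw [thS_trans _ hτ 1 (by norm_num), sqrt5_fact hτ, eta_trans hτ, five_sum, cos_b, exp_b,
      ← h1, ← h2] at h1'
    rw [thS_trans _ hτ 0 (by norm_num), sqrt5_fact hτ, eta_trans hτ, five_sum, cos_a, exp_a,
      ← h1, ← h2] at h2'
    constructor
    · apply mul_right_cancel₀ (mul_ne_zero hw he)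
      rw [h1']
      push_cast
      ring
    · apply mul_right_cancel₀ (mul_ne_zero hw he)
      rw [h2']
      push_cast
      ring
  refine ⟨main, ?_, ?_⟩
  · rw [Submodule.mem_span_pair]
    refine ⟨(2 / Real.sqrt 5 : ℝ) * -(Real.sin (2 * Real.pi / 5) : ℝ),
      (2 / Real.sqrt 5 : ℝ) * (Real.sin (4 * Real.pi / 5) : ℝ), ?_⟩
    funext τ
    change _ * chOne τ + _ * chTwo τ = chOne (-1 / (τ : ℂ))
    rw [(main τ τ.2).1]
    ring
  · rw [Submodule.mem_span_pair]
    refine ⟨(2 / Real.sqrt 5 : ℝ) * (Real.sin (4 * Real.pi / 5) : ℝ),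
      (2 / Real.sqrt 5 : ℝ) * (Real.sin (2 * Real.pi / 5) : ℝ), ?_⟩
    funext τ
    change _ * chOne τ + _ * chTwo τ = chTwo (-1 / (τ : ℂ))
    rw [(main τ τ.2).2]
    ring
end

section
/- For every τ in the upper half-plane ℍ: f₁(τ)⁵·f₂(τ) − f₂(τ)⁵·f₁(τ) = 2. -/
open Complex

/-- `∑_{n∈ℤ} q^{n²}`, `q = e^{2πiτ}`. -/
noncomputable def thetaInt (τ : ℂ) : ℂ :=
  ∑' n : ℤ, Complex.exp (2 * (Real.pi : ℂ) * I * (n : ℂ) ^ 2 * τ)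

/-- `∑_{n∈ℤ} q^{(n+1/2)²}`, `q = e^{2πiτ}`. -/
noncomputable def thetaHalf (τ : ℂ) : ℂ :=
  ∑' n : ℤ, Complex.exp (2 * (Real.pi : ℂ) * I * ((n : ℂ) + 1 / 2) ^ 2 * τ)

/-- The Dedekind eta function `η(τ) = e^{πiτ/12} ∏_{n≥1}(1 − e^{2πinτ})`. -/
noncomputable def dedekindEta (τ : ℂ) : ℂ :=
  Complex.exp ((Real.pi : ℂ) * I * τ / 12) *
    ∏' n : ℕ, (1 - Complex.exp (2 * (Real.pi : ℂ) * I * ((n : ℂ) + 1) * τ))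

/-- `f₁ = (∑_{n∈ℤ} q^{n²})/η`. -/
noncomputable def fOne (τ : ℂ) : ℂ := thetaInt τ / dedekindEta τ

/-- `f₂ = (∑_{n∈ℤ} q^{(n+1/2)²})/η`. -/
noncomputable def fTwo (τ : ℂ) : ℂ := thetaHalf τ / dedekindEta τ


open UpperHalfPlane hiding I

open Filter

open scoped Real Topology MatrixGroups ModularForm

/-- `∑ q^{n²}` as a value of the two-variable Jacobi theta function. -/
lemma thetaInt_eq (τ : ℂ) : thetaInt τ = jacobiTheta₂ 0 (2 * τ) := by
  unfold thetaInt jacobiTheta₂ jacobiTheta₂_term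
  refine tsum_congr fun n ↦ ?_
  congr 1; ring

lemma thetaHalf_eq (τ : ℂ) :
    thetaHalf τ = cexp (π * I * τ / 2) * jacobiTheta₂ τ (2 * τ) := by
  unfold thetaHalf jacobiTheta₂ jacobiTheta₂_term
  rw [← tsum_mul_left]
  refine tsum_congr fun n ↦ ?_
  rw [← Complex.exp_add]
  congr 1; ring

lemma dedekindEta_eq (τ : ℂ) : dedekindEta τ = ModularForm.eta τ := by
  unfold dedekindEta ModularForm.eta
  simp_rw [ModularForm.eta_q_eq_cexp]
  congr 1
  simp only [Function.Periodic.qParam]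
  congr 1
  push_cast
  ring

/-- splitting an integer-indexed sum into even and odd parts -/
lemma hasSum_int_even_odd {f : ℤ → ℂ} {a b : ℂ} (he : HasSum (fun n : ℤ ↦ f (2 * n)) a)
    (ho : HasSum (fun n : ℤ ↦ f (2 * n + 1)) b) : HasSum f (a + b) := by
  have h1 := mul_right_injective₀ (two_ne_zero' ℤ)
  have h2 := (add_left_injective (1 : ℤ)).comp h1
  replace ho := h2.hasSum_range_iff.2 ho
  refine (h1.hasSum_range_iff.2 he).add_isCompl ?_ ho
  have e1 : Set.range (fun x : ℤ ↦ 2 * x) = {n | Even n} := by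
    ext n; simp [even_iff_exists_two_mul]
  have e2 : Set.range ((fun x : ℤ ↦ x + 1) ∘ fun x : ℤ ↦ 2 * x) = {n | Odd n} := by
    ext n; simp [Odd, eq_comm]
  rw [e1, e2]
  exact Int.isCompl_even_odd

lemma hasSum_thetaInt {τ : ℂ} (hτ : 0 < τ.im) :
    HasSum (fun n : ℤ ↦ cexp (2 * π * I * (n : ℂ) ^ 2 * τ)) (thetaInt τ) := by
  rw [thetaInt_eq]
  convert hasSum_jacobiTheta₂_term 0 (τ := 2 * τ) (by simpa using hτ) using 2 with n
  unfold jacobiTheta₂_term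
  congr 1; ring

lemma hasSum_thetaHalf {τ : ℂ} (hτ : 0 < τ.im) :
    HasSum (fun n : ℤ ↦ cexp (2 * π * I * ((n : ℂ) + 1 / 2) ^ 2 * τ)) (thetaHalf τ) := by
  rw [thetaHalf_eq]
  have h := (hasSum_jacobiTheta₂_term τ (τ := 2 * τ) (by simpa using hτ)).mul_left
    (cexp (π * I * τ / 2))
  refine (congrArg (HasSum · _) (funext fun n ↦ ?_)).mp h
  symm
  unfold jacobiTheta₂_term
  rw [← Complex.exp_add]
  congr 1; ring

lemma theta_sum {τ : ℂ} (hτ : 0 < τ.im) :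
    jacobiTheta₂ 0 (τ / 2) = thetaInt τ + thetaHalf τ := by
  refine HasSum.tsum_eq (hasSum_int_even_odd ?_ ?_)
  · convert hasSum_thetaInt hτ using 2 with n
    unfold jacobiTheta₂_term
    congr 1; push_cast; ring
  · convert hasSum_thetaHalf hτ using 2 with n
    unfold jacobiTheta₂_term
    congr 1; push_cast; ring

lemma theta_diff {τ : ℂ} (hτ : 0 < τ.im) :
    jacobiTheta₂ (1 / 2) (τ / 2) = thetaInt τ - thetaHalf τ := by
  rw [sub_eq_add_neg]
  refine HasSum.tsum_eq (hasSum_int_even_odd ?_ ?_)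
  · convert hasSum_thetaInt hτ using 2 with n
    unfold jacobiTheta₂_term
    rw [show 2 * π * I * ((2 * n : ℤ) : ℂ) * (1 / 2) + π * I * ((2 * n : ℤ) : ℂ) ^ 2 * (τ / 2)
      = 2 * π * I * (n : ℂ) ^ 2 * τ + n * (2 * π * I) by push_cast; ring, Complex.exp_add,
      exp_int_mul_two_pi_mul_I, mul_one]
  · refine (congrArg (HasSum · _) (funext fun n ↦ ?_)).mp (hasSum_thetaHalf hτ).neg
    symm
    unfold jacobiTheta₂_term
    rw [show 2 * π * I * ((2 * n + 1 : ℤ) : ℂ) * (1 / 2) +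
        π * I * ((2 * n + 1 : ℤ) : ℂ) ^ 2 * (τ / 2)
      = 2 * π * I * ((n : ℂ) + 1 / 2) ^ 2 * τ + n * (2 * π * I) + π * I by push_cast; ring,
      Complex.exp_add, Complex.exp_add, exp_int_mul_two_pi_mul_I, exp_pi_mul_I]
    ring

/-- `S`-transformation of the two theta functions. -/
lemma thetaInt_S {τ : ℂ} (hτ : 0 < τ.im) : thetaInt (-1 / τ) =
    (-I * (τ / 2)) ^ (1 / 2 : ℂ) * (thetaInt τ + thetaHalf τ) := by
  have h0 : τ ≠ 0 := by rintro rfl; simp at hτ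
  have hc : (-I * (τ / 2)) ^ (1 / 2 : ℂ) ≠ 0 := by
    simp [Complex.cpow_eq_zero_iff, h0]
  have h := jacobiTheta₂_functional_equation 0 (τ / 2)
  rw [← theta_sum hτ, h, thetaInt_eq]
  rw [show -1 / (τ / 2) = 2 * (-1 / τ) by field_simp]
  simp
  field_simp

lemma thetaHalf_S {τ : ℂ} (hτ : 0 < τ.im) : thetaHalf (-1 / τ) =
    (-I * (τ / 2)) ^ (1 / 2 : ℂ) * (thetaInt τ - thetaHalf τ) := by
  have h0 : τ ≠ 0 := by rintro rfl; simp at hτ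
  have hc : (-I * (τ / 2)) ^ (1 / 2 : ℂ) ≠ 0 := by
    simp [Complex.cpow_eq_zero_iff, h0]
  have h := jacobiTheta₂_functional_equation (1 / 2) (τ / 2)
  rw [← theta_diff hτ, h, thetaHalf_eq, ← jacobiTheta₂_neg_left (-1 / τ)]
  rw [show -1 / (τ / 2) = 2 * (-1 / τ) by field_simp,
    show -(-1 / τ) = 1 / 2 / (τ / 2) by field_simp,
    show π * I * (-1 / τ) / 2 = -π * I * (1 / 2) ^ 2 / (τ / 2) by field_simp]
  rw [← mul_assoc, ← mul_assoc, mul_one_div_cancel hc, one_mul]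

lemma thetaInt_T (τ : ℂ) : thetaInt (τ + 1) = thetaInt τ := by
  unfold thetaInt
  refine tsum_congr fun n ↦ ?_
  rw [show 2 * π * I * (n : ℂ) ^ 2 * (τ + 1) =
    2 * π * I * (n : ℂ) ^ 2 * τ + ((n ^ 2 : ℤ) : ℂ) * (2 * π * I) by push_cast; ring,
    Complex.exp_add, exp_int_mul_two_pi_mul_I, mul_one]

lemma thetaHalf_T (τ : ℂ) : thetaHalf (τ + 1) = I * thetaHalf τ := by
  unfold thetaHalf
  rw [← tsum_mul_left]
  refine tsum_congr fun n ↦ ?_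
  rw [show 2 * π * I * ((n : ℂ) + 1 / 2) ^ 2 * (τ + 1) =
    π / 2 * I + 2 * π * I * ((n : ℂ) + 1 / 2) ^ 2 * τ + ((n ^ 2 + n : ℤ) : ℂ) * (2 * π * I) by
      push_cast; ring,
    Complex.exp_add, exp_int_mul_two_pi_mul_I, mul_one, Complex.exp_add, exp_pi_div_two_mul_I]

lemma cpow_half_pow_six {z : ℂ} : (z ^ (1 / 2 : ℂ)) ^ 6 = z ^ 3 := by
  rw [← Complex.cpow_nat_mul, ← Complex.cpow_natCast z 3]
  norm_num

lemma eta_S {τ : ℂ} (hτ : 0 < τ.im) : dedekindEta (-1 / τ) ^ 6 = I * τ ^ 3 * dedekindEta τ ^ 6 := by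
  have h := ModularForm.eta_comp_eq_csqrt_I_inv (x := τ) hτ
  simp only [Function.comp_apply, Pi.smul_apply, Pi.mul_apply, smul_eq_mul] at h
  rw [dedekindEta_eq, dedekindEta_eq, h, mul_pow, mul_pow, inv_pow]
  have hs (z : ℂ) : Complex.sqrt z ^ 6 = z ^ 3 := by
    rw [← cpow_half_pow_six]
    simp [Complex.sqrt]
  rw [hs, hs, I_pow_three, inv_neg, inv_I]
  ring

lemma eta_T (τ : ℂ) : dedekindEta (τ + 1) ^ 6 = I * dedekindEta τ ^ 6 := by
  unfold dedekindEta
  have h1 (n : ℕ) : cexp (2 * π * I * ((n : ℂ) + 1) * (τ + 1)) =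
      cexp (2 * π * I * ((n : ℂ) + 1) * τ) := by
    rw [show 2 * π * I * ((n : ℂ) + 1) * (τ + 1) =
      2 * π * I * ((n : ℂ) + 1) * τ + ((n + 1 : ℤ) : ℂ) * (2 * π * I) by push_cast; ring,
      Complex.exp_add, exp_int_mul_two_pi_mul_I, mul_one]
  simp_rw [h1]
  rw [mul_pow, mul_pow, ← mul_assoc, ← Complex.exp_nat_mul, ← Complex.exp_nat_mul,
    show ((6 : ℕ) : ℂ) * (π * I * (τ + 1) / 12) = π / 2 * I + (6 : ℕ) * (π * I * τ / 12) by
      push_cast; ring, Complex.exp_add, exp_pi_div_two_mul_I]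

/-- the function in question -/
noncomputable def gFun (τ : ℂ) : ℂ := fOne τ ^ 5 * fTwo τ - fTwo τ ^ 5 * fOne τ

lemma gFun_eq (τ : ℂ) : gFun τ =
    (thetaInt τ * thetaHalf τ * (thetaInt τ ^ 4 - thetaHalf τ ^ 4)) / dedekindEta τ ^ 6 := by
  unfold gFun fOne fTwo
  simp only [div_pow, div_mul_div_comm, ← pow_succ, ← sub_div]
  congr 1
  ring

lemma eta_ne {τ : ℂ} (hτ : 0 < τ.im) : dedekindEta τ ≠ 0 := by
  rw [dedekindEta_eq]; exact ModularForm.eta_ne_zero hτ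

lemma gFun_T (τ : ℂ) : gFun (τ + 1) = gFun τ := by
  rw [gFun_eq, gFun_eq, thetaInt_T, thetaHalf_T, eta_T, mul_pow, I_pow_four, one_mul,
    show thetaInt τ * (I * thetaHalf τ) * (thetaInt τ ^ 4 - thetaHalf τ ^ 4) =
      I * (thetaInt τ * thetaHalf τ * (thetaInt τ ^ 4 - thetaHalf τ ^ 4)) by ring,
    mul_div_mul_left _ _ I_ne_zero]

lemma gFun_S {τ : ℂ} (hτ : 0 < τ.im) : gFun (-1 / τ) = gFun τ := by
  have h0 : τ ≠ 0 := by rintro rfl; simp at hτ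
  rw [gFun_eq, gFun_eq, thetaInt_S hτ, thetaHalf_S hτ, eta_S hτ]
  set c := (-I * (τ / 2)) ^ (1 / 2 : ℂ) with hc
  have hc6 : c ^ 6 = I * τ ^ 3 / 8 := by
    rw [hc, cpow_half_pow_six, mul_pow, neg_pow, I_pow_three]; ring
  set a := thetaInt τ
  set b := thetaHalf τ
  rw [show c * (a + b) * (c * (a - b)) * ((c * (a + b)) ^ 4 - (c * (a - b)) ^ 4) =
    c ^ 6 * 8 * (a * b * (a ^ 4 - b ^ 4)) by ring, hc6,
    div_mul_cancel₀ _ (by norm_num : (8 : ℂ) ≠ 0),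
    mul_div_mul_left _ _ (mul_ne_zero I_ne_zero (pow_ne_zero 3 h0))]

lemma gFun_differentiableAt {τ : ℂ} (hτ : 0 < τ.im) : DifferentiableAt ℂ gFun τ := by
  have h2 : 0 < (2 * τ).im := by simpa using hτ
  have ha : DifferentiableAt ℂ thetaInt τ := by
    rw [funext thetaInt_eq]
    exact (differentiableAt_jacobiTheta₂_snd 0 h2).comp τ (by fun_prop)
  have hb : DifferentiableAt ℂ thetaHalf τ := by
    rw [funext thetaHalf_eq]
    refine DifferentiableAt.mul (by fun_prop) ?_
    exact (hasFDerivAt_jacobiTheta₂ τ h2).differentiableAt.comp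
      (f := fun t : ℂ ↦ (t, 2 * t)) τ (by fun_prop)
  have he : DifferentiableAt ℂ dedekindEta τ := by
    rw [funext dedekindEta_eq]
    exact ModularForm.differentiableAt_eta_of_mem_upperHalfPlaneSet hτ
  rw [funext gFun_eq]
  exact ((ha.mul hb).mul ((ha.pow 4).sub (hb.pow 4))).div (he.pow 6) (pow_ne_zero _ (eta_ne hτ))

/-! ### Limits at infinity -/

lemma tendsto_cexp_atImInfty {c : ℝ} (hc : 0 < c) :
    Tendsto (fun τ : ℍ ↦ cexp (c * I * τ)) atImInfty (𝓝 0) := by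
  rw [tendsto_zero_iff_norm_tendsto_zero]
  have : (fun τ : ℍ ↦ ‖cexp (c * I * τ)‖) = fun τ : ℍ ↦ Real.exp (-(c * τ.im)) := by
    ext τ
    simp [Complex.norm_exp]
  rw [this]
  exact Real.tendsto_exp_neg_atTop_nhds_zero.comp
    ((tendsto_comap (f := UpperHalfPlane.im)).const_mul_atTop hc)

lemma tendsto_term_sum {m : ℤ → ℕ} (hs : Summable fun n ↦ Real.exp (-(2 * π * m n)))
    (g : ℤ → ℂ) (hg : ∀ n, g n = if m n = 0 then 1 else 0) :
    Tendsto (fun τ : ℍ ↦ ∑' n : ℤ, cexp (2 * π * I * (m n : ℂ) * τ)) atImInfty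
      (𝓝 (∑' n, g n)) := by
  refine tendsto_tsum_of_dominated_convergence hs (fun n ↦ ?_) ?_
  · rw [hg]
    split_ifs with h
    · simp [h]
    · have := tendsto_cexp_atImInfty (c := 2 * π * m n) (by positivity)
      refine this.congr fun τ ↦ ?_
      congr 1; push_cast; ring
  · have : ∀ᶠ τ : ℍ in atImInfty, 1 ≤ τ.im :=
      (tendsto_comap (f := UpperHalfPlane.im)).eventually_ge_atTop 1
    filter_upwards [this] with τ hτ n
    rw [Complex.norm_exp]
    have : (2 * π * I * (m n : ℂ) * (τ : ℂ)).re = -(2 * π * m n * τ.im) := by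
      rw [show 2 * π * I * (m n : ℂ) * (τ : ℂ) = ((2 * π * m n : ℝ) : ℂ) * (I * τ) by
        push_cast; ring, re_ofReal_mul]
      simp
    rw [this, Real.exp_le_exp, neg_le_neg_iff]
    exact le_mul_of_one_le_right (by positivity) hτ

lemma tendsto_thetaInt : Tendsto (fun τ : ℍ ↦ thetaInt τ) atImInfty (𝓝 1) := by
  have h := tendsto_term_sum (m := fun n ↦ (n ^ 2).toNat) ?_
    (fun n ↦ if n = 0 then 1 else 0) ?_
  · rw [tsum_ite_eq] at h
    refine h.congr fun τ ↦ tsum_congr fun n ↦ ?_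
    have : (((n ^ 2).toNat : ℤ) : ℂ) = (n : ℂ) ^ 2 := by
      rw [Int.toNat_of_nonneg (sq_nonneg n)]; push_cast; rfl
    rw [← this, Int.cast_natCast]
  · have h := (hasSum_thetaInt (τ := I) (by simp)).summable.norm
    refine h.congr fun n ↦ ?_
    have : (((n ^ 2).toNat : ℤ) : ℝ) = (n : ℝ) ^ 2 := by
      rw [Int.toNat_of_nonneg (sq_nonneg n)]; push_cast; rfl
    rw [Complex.norm_exp, Int.cast_natCast] at *
    rw [this, show 2 * π * I * (n : ℂ) ^ 2 * I = ((2 * π * (n : ℝ) ^ 2 : ℝ) : ℂ) * (I * I) by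
      push_cast; ring, re_ofReal_mul]
    simp
  · intro n
    have : (n ^ 2).toNat = 0 ↔ n = 0 := by
      rw [Int.toNat_eq_zero]
      constructor
      · intro h; nlinarith [sq_nonneg n, pow_eq_zero_iff (two_ne_zero) |>.1 (le_antisymm h (sq_nonneg n))]
      · rintro rfl; simp
    simp [this]

lemma int_sq_add_nonneg (n : ℤ) : 0 ≤ n ^ 2 + n := by
  rcases le_or_gt 0 n with h | h
  · positivity
  · nlinarith

lemma tendsto_thetaHalf_aux :
    Tendsto (fun τ : ℍ ↦ jacobiTheta₂ τ (2 * τ)) atImInfty (𝓝 2) := by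
  have h := tendsto_term_sum (m := fun n ↦ (n ^ 2 + n).toNat) ?_
    (fun n ↦ (if n = 0 then 1 else 0) + (if n = -1 then 1 else 0)) ?_
  · have hsum : ∑' n : ℤ, ((if n = 0 then (1 : ℂ) else 0) + (if n = -1 then 1 else 0)) = 2 := by
      have := ((hasSum_ite_eq (0 : ℤ) (1 : ℂ)).add (hasSum_ite_eq (-1 : ℤ) (1 : ℂ))).tsum_eq
      rw [this]; norm_num
    rw [hsum] at h
    refine h.congr fun τ ↦ tsum_congr fun n ↦ ?_
    have : (((n ^ 2 + n).toNat : ℤ) : ℂ) = (n : ℂ) ^ 2 + n := by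
      rw [Int.toNat_of_nonneg (int_sq_add_nonneg n)]; push_cast; rfl
    rw [Int.cast_natCast] at this
    rw [this, jacobiTheta₂_term]
    congr 1; ring
  · have h := (hasSum_jacobiTheta₂_term I (τ := 2 * I) (by simp)).summable.norm
    refine h.congr fun n ↦ ?_
    have : (((n ^ 2 + n).toNat : ℤ) : ℝ) = (n : ℝ) ^ 2 + n := by
      rw [Int.toNat_of_nonneg (int_sq_add_nonneg n)]; push_cast; rfl
    rw [Int.cast_natCast] at this
    rw [norm_jacobiTheta₂_term, this]
    congr 1
    simp
    ring
  · intro n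
    have : (n ^ 2 + n).toNat = 0 ↔ n = 0 ∨ n = -1 := by
      rw [Int.toNat_eq_zero]
      constructor
      · intro h
        have h1 : n * (n + 1) = 0 := by linarith [le_antisymm h (int_sq_add_nonneg n)]
        rcases mul_eq_zero.1 h1 with h | h
        · exact .inl h
        · exact .inr (by linarith)
      · rintro (rfl | rfl) <;> simp
    simp only [this]
    rcases eq_or_ne n 0 with rfl | h0
    · simp
    · rcases eq_or_ne n (-1) with rfl | h1 <;> simp [*]

lemma tendsto_thetaHalf : Tendsto (fun τ : ℍ ↦ thetaHalf τ) atImInfty (𝓝 0) := by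
  have h := (tendsto_cexp_atImInfty (c := π / 2) (by positivity)).mul tendsto_thetaHalf_aux
  rw [zero_mul] at h
  refine h.congr fun τ ↦ ?_
  rw [thetaHalf_eq]
  congr 2; push_cast; ring

lemma tendsto_prod : Tendsto
    (fun τ : ℍ ↦ ∏' n : ℕ, (1 - cexp (2 * π * I * ((n : ℂ) + 1) * τ))) atImInfty (𝓝 1) := by
  have hc : ContinuousAt (fun q : ℂ ↦ ∏' n : ℕ, (1 - q ^ (n + 1))) 0 :=
    (ModularForm.differentiableOn_tprod_one_sub_pow.differentiableAt
      (Metric.isOpen_ball.mem_nhds (by simp))).continuousAt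
  have h := hc.tendsto.comp (tendsto_cexp_atImInfty (c := 2 * π) (by positivity))
  simp only [ne_eq, Nat.add_eq_zero_iff, one_ne_zero, and_false, not_false_eq_true, zero_pow,
    sub_zero, tprod_one] at h
  refine h.congr fun τ ↦ tprod_congr fun n ↦ ?_
  rw [← Complex.exp_nat_mul]
  congr 2; push_cast; ring

lemma tendsto_gFun : Tendsto (fun τ : ℍ ↦ gFun τ) atImInfty (𝓝 2) := by
  have h := ((tendsto_thetaInt.mul tendsto_thetaHalf_aux).mul
    ((tendsto_thetaInt.pow 4).sub (tendsto_thetaHalf.pow 4))).div (tendsto_prod.pow 6) (by simp)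
  norm_num at h
  refine h.congr fun τ ↦ ?_
  rw [gFun_eq, dedekindEta, mul_pow, ← Complex.exp_nat_mul]
  rw [show ((6 : ℕ) : ℂ) * (π * I * τ / 12) = π * I * τ / 2 by push_cast; ring]
  simp only [Pi.div_apply]
  nth_rewrite 2 [thetaHalf_eq]
  rw [show thetaInt τ * (cexp (π * I * τ / 2) * jacobiTheta₂ τ (2 * τ)) *
    (thetaInt τ ^ 4 - thetaHalf τ ^ 4) = cexp (π * I * τ / 2) * (thetaInt τ *
      jacobiTheta₂ τ (2 * τ) * (thetaInt τ ^ 4 - thetaHalf τ ^ 4)) by ring]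
  rw [mul_div_mul_left _ _ (Complex.exp_ne_zero _)]

lemma gFun_slash (γ : SL(2, ℤ)) :
    (fun τ : ℍ ↦ gFun τ) ∣[(0 : ℤ)] γ = fun τ : ℍ ↦ gFun τ := by
  refine SlashInvariantForm.slash_action_generators_SL2Z ?_ ?_ γ
  · ext τ
    rw [ModularForm.SL_slash_apply, UpperHalfPlane.modular_S_smul]
    have := gFun_S τ.2
    simpa [neg_div] using this
  · ext τ
    rw [ModularForm.SL_slash_apply, UpperHalfPlane.modular_T_smul]
    have := gFun_T τ
    simpa [add_comm] using this

/-- the function `gFun` as a level one modular form of weight `0` -/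
noncomputable def gForm : ModularForm 𝒮ℒ 0 where
  toFun τ := gFun τ
  slash_action_eq' := fun _ ⟨γ, hγ⟩ ↦ hγ ▸ gFun_slash γ
  holo' := by
    rw [UpperHalfPlane.mdifferentiable_iff]
    refine .congr (fun z hz ↦ (gFun_differentiableAt hz).differentiableWithinAt) fun z hz ↦ ?_
    simp [ofComplex_apply_of_im_pos hz]
  bdd_at_cusps' {c} hc := by
    rw [Subgroup.IsArithmetic.isCusp_iff_isCusp_SL2Z] at hc
    rw [OnePoint.isBoundedAt_iff_forall_SL2Z hc]
    intro γ _
    rw [gFun_slash γ, IsBoundedAtImInfty, BoundedAtFilter]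
    exact tendsto_gFun.isBigO_one ℝ

/-- for every `τ ∈ ℍ`, `f₁(τ)⁵·f₂(τ) − f₂(τ)⁵·f₁(τ) = 2`. -/
theorem stmt_10 (τ : ℂ) (hτ : 0 < τ.im) :
    fOne τ ^ 5 * fTwo τ - fTwo τ ^ 5 * fOne τ = 2 := by
  obtain ⟨c, hc⟩ := ModularFormClass.levelOne_weight_zero_const gForm
  have hc' (z : ℍ) : gFun z = c := congrFun hc z
  have h2 : c = 2 := by
    refine tendsto_nhds_unique ?_ tendsto_gFun
    simp only [hc']
    exact tendsto_const_nhds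
  exact (hc' ⟨τ, hτ⟩).trans h2
end

section
/- Fix λ ∈ ℂ, let m = 12 and Q = λ·G₄, and define holomorphic functions R₁,…,R₁₂ on ℍ by R₁ = 12·Q, R₂ = 12·((q d/dq)Q + 4·G₂·Q), and R_{i+1} = (q d/dq)R_i + (2i+2)·G₂·R_i + (i+1)(12−i)·Q·R_{i−1} for 2 ≤ i ≤ 11. Then R₁₂ vanishes identically on ℍ if and only if λ ∈ {−11/5, −25/4, −15, −40, 0}. -/
open Complex

/-- The Eisenstein series `G₂(τ) = −1/12 + 2∑_{n≥1} n qⁿ/(1−qⁿ)`, `q = e^{2πiτ}`. -/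
noncomputable def GTwo (τ : ℂ) : ℂ :=
  -(1 / 12) + 2 * ∑' n : ℕ, ((n : ℂ) + 1) * Complex.exp (2 * (Real.pi : ℂ) * I * τ) ^ (n + 1) /
    (1 - Complex.exp (2 * (Real.pi : ℂ) * I * τ) ^ (n + 1))

/-- The Eisenstein series `G₄(τ) = 1/720 + (1/3)∑_{n≥1} n³ qⁿ/(1−qⁿ)`, `q = e^{2πiτ}`. -/
noncomputable def GFour (τ : ℂ) : ℂ :=
  1 / 720 + (1 / 3) * ∑' n : ℕ, ((n : ℂ) + 1) ^ 3 *
    Complex.exp (2 * (Real.pi : ℂ) * I * τ) ^ (n + 1) /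
      (1 - Complex.exp (2 * (Real.pi : ℂ) * I * τ) ^ (n + 1))

namespace Stmt12Aux

open UpperHalfPlane hiding I
open ModularForm EisensteinSeries Filter Topology Derivative
open scoped MatrixGroups Manifold CongruenceSubgroup

lemma zero_of_cusp {k : ℤ} (hk : k < 12) (f : ℍ → ℂ) (hd : MDiff f)
    (hs : ∀ γ : SL(2, ℤ), f ∣[k] γ = f) (h0 : Tendsto f atImInfty (𝓝 0)) : f = 0 := by
  let g : CuspForm 𝒮ℒ k :=
    { toFun := f
      slash_action_eq' := fun A hA => by
        obtain ⟨A, rfl⟩ := hA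
        exact hs A
      holo' := hd
      zero_at_cusps' := fun hc => by
        rw [Subgroup.IsArithmetic.isCusp_iff_isCusp_SL2Z] at hc
        rw [OnePoint.isZeroAt_iff_forall_SL2Z hc]
        intro γ _
        rw [hs]
        exact h0 }
  have hg : g = 0 :=
    rank_zero_iff_forall_zero.mp (CuspForm.rank_eq_zero_of_weight_lt_twelve hk) g
  have : (g : ℍ → ℂ) = 0 := by rw [hg]; rfl
  exact this

lemma tendsto_of_hasSum {f : ℍ → ℂ} {c : ℕ → ℂ} (hd : MDiff f)
    (hf : ∀ τ : ℍ, HasSum (fun m ↦ c m • Function.Periodic.qParam (1 : ℝ) τ ^ m) (f τ)) :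
    Tendsto f atImInfty (𝓝 (c 0)) := by
  have hb : IsBoundedAtImInfty f := isBoundedAtImInfty_of_hasSum_qExpansion one_pos hf
  have hper : Function.Periodic (f ∘ ofComplex) (1 : ℝ) := by
    intro z
    by_cases hz : 0 < z.im
    · have hz' : 0 < (z + (1 : ℝ)).im := by simpa using hz
      simp only [Function.comp_apply, ofComplex_apply_of_im_pos hz, ofComplex_apply_of_im_pos hz']
      refine (hf _).unique ?_
      have := hf ⟨z, hz⟩
      convert! this using 4
      simp only [Function.Periodic.qParam, ofReal_one, div_one, mul_add, mul_one, Complex.exp_add,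
        Complex.exp_two_pi_mul_I]
    · have hz' : (z + (1 : ℝ)).im ≤ 0 := by simpa using hz
      simp only [Function.comp_apply, ofComplex_apply_of_im_nonpos (not_lt.mp hz),
        ofComplex_apply_of_im_nonpos hz']
  have han := analyticAt_cuspFunction_zero one_pos hper hd hb
  have h0 : c 0 = cuspFunction 1 f 0 := by
    have h1 := (UpperHalfPlane.hasFPowerSeriesOnBall_cuspFunction one_pos han hf).coeff_zero
      (fun _ => 1)
    simpa [FormalMultilinearSeries.ofScalars] using h1
  rw [h0]
  refine (han.continuousAt.tendsto.comp (qParam_tendsto_atImInfty one_pos)).congr fun τ ↦ ?_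
  exact eq_cuspFunction τ one_ne_zero hper

lemma tendsto_E2 : Tendsto E2 atImInfty (𝓝 1) := by
  have := tendsto_of_hasSum (f := E2) (c := fun m => if m = 0 then 1 else -24 * ArithmeticFunction.sigma 1 m)
    E2_mdifferentiable (fun τ => by
      simpa only [Function.Periodic.qParam, ofReal_one, div_one] using hasSum_qExpansion_E2 (z := τ))
  simpa using this

lemma tendsto_E {k : ℕ} (hk : 3 ≤ k) (hk2 : Even k) :
    Tendsto (E hk : ℍ → ℂ) atImInfty (𝓝 1) := by
  have := tendsto_of_hasSum (f := E hk) (c := fun m => (qExpansion 1 (E hk)).coeff m)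
    (ModularFormClass.holo (E hk))
    (fun τ => ModularForm.hasSum_qExpansion (E hk) one_pos one_mem_strictPeriods_SL τ)
  rwa [E_qExpansion_coeff_zero hk hk2] at this

lemma tendsto_D {f : ℍ → ℂ} {c : ℂ} (hd : MDiff f) (hf : Tendsto f atImInfty (𝓝 c)) :
    Tendsto (normalizedDerivOfComplex f) atImInfty (𝓝 0) := by
  suffices h : Tendsto (fun z : ℍ => deriv (f ∘ ofComplex) z) atImInfty (𝓝 0) by
    have h' := h.const_mul ((2 * (Real.pi : ℂ) * I)⁻¹)
    rw [mul_zero] at h'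
    exact h'
  rw [UpperHalfPlane.mdifferentiable_iff] at hd
  rw [Metric.tendsto_nhds]
  intro ε hε
  have := (Metric.tendsto_nhds.mp hf (ε / 2) (by positivity))
  obtain ⟨A, hA⟩ := (atImInfty_mem _).mp this
  refine (atImInfty_mem _).mpr ⟨max A 0 + 2, fun z hz => ?_⟩
  have hz1 : A + 2 ≤ z.im := le_trans (by gcongr; exact le_max_left _ _) hz
  have hz2 : 0 + 2 ≤ z.im := le_trans (by gcongr; exact le_max_right _ _) hz
  have him : ∀ w ∈ Metric.closedBall (z : ℂ) 1, z.im - 1 ≤ w.im := by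
    intro w hw
    have h1 : ‖w - z‖ ≤ 1 := by simpa [dist_eq_norm] using hw
    have h2 := (abs_le.mp ((Complex.abs_im_le_norm (w - z)).trans h1)).1
    simp at h2
    linarith
  have hdc : DiffContOnCl ℂ (fun w => (f ∘ ofComplex) w - c) (Metric.ball (z : ℂ) 1) := by
    apply DifferentiableOn.diffContOnCl
    rw [closure_ball _ one_ne_zero]
    refine (hd.mono fun w hw => ?_).sub_const c
    have := him w hw
    simp only [Set.mem_ofPred_eq]
    linarith
  have hle := Complex.norm_deriv_le_of_forall_mem_sphere_norm_le one_pos hdc (C := ε / 2)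
    (fun w hw => by
      have h1 := him w (Metric.sphere_subset_closedBall hw)
      have hw0 : 0 < w.im := by linarith
      have := hA ⟨w, hw0⟩ (by change A ≤ w.im; linarith)
      simp only [Set.mem_ofPred_eq, dist_eq_norm] at this
      simp only [Function.comp_apply, ofComplex_apply_of_im_pos hw0]
      exact this.le)
  rw [deriv_sub_const] at hle
  simp only [Set.mem_ofPred_eq, dist_zero_right]
  linarith

lemma tendsto_serre {f : ℍ → ℂ} {c : ℂ} (k : ℂ) (hd : MDiff f) (hf : Tendsto f atImInfty (𝓝 c)) :
    Tendsto (serreDerivative k f) atImInfty (𝓝 (- k / 12 * c)) := by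
  have := (tendsto_D hd hf).sub (((tendsto_E2.const_mul (k * 12⁻¹))).mul hf)
  convert! this using 2
  ring

lemma serre_E4 (z : ℍ) : serreDerivative 4 E₄ z = - (1 / 3) * E₆ z := by
  have hd4 : MDiff (E₄ : ℍ → ℂ) := ModularFormClass.holo E₄
  have hd6 : MDiff (E₆ : ℍ → ℂ) := ModularFormClass.holo E₆
  have hmd : MDiff (serreDerivative 4 E₄ + (1 / 3 : ℂ) • (E₆ : ℍ → ℂ)) :=
    (serreDerivative_mdifferentiable 4 hd4).add (hd6.const_smul _)
  have key := zero_of_cusp (k := 6) (by norm_num) (serreDerivative 4 E₄ + (1 / 3 : ℂ) • (E₆ : ℍ → ℂ))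
    hmd
    (fun γ => by
      rw [SlashAction.add_slash, ModularForm.SL_smul_slash]
      have h4 : (E₄ : ℍ → ℂ) ∣[(4 : ℤ)] γ = E₄ := E₄.slash_action_eq' _ ⟨γ, rfl⟩
      have h6 : (E₆ : ℍ → ℂ) ∣[(6 : ℤ)] γ = E₆ := E₆.slash_action_eq' _ ⟨γ, rfl⟩
      have := serreDerivative_slash_invariant hd4 h4
      rw [show ((4 : ℤ) : ℂ) = 4 by norm_num, show (4 + 2 : ℤ) = 6 by norm_num] at this
      rw [this, h6])
    (by
      have := (tendsto_serre 4 hd4 (tendsto_E (by norm_num) ⟨2, rfl⟩)).add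
        ((tendsto_E (k := 6) (by norm_num) ⟨3, rfl⟩).const_smul (1 / 3 : ℂ))
      convert! this using 2
      norm_num)
  have := congrFun key z
  simp only [Pi.add_apply, Pi.smul_apply, smul_eq_mul, Pi.zero_apply] at this
  linear_combination this

lemma serre_E6 (z : ℍ) : serreDerivative 6 E₆ z = - (1 / 2) * E₄ z ^ 2 := by
  have hd4 : MDiff (E₄ : ℍ → ℂ) := ModularFormClass.holo E₄
  have hd6 : MDiff (E₆ : ℍ → ℂ) := ModularFormClass.holo E₆
  have hmd : MDiff (serreDerivative 6 E₆ + (1 / 2 : ℂ) • ((E₄ : ℍ → ℂ) * E₄)) :=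
    (serreDerivative_mdifferentiable 6 hd6).add ((hd4.mul hd4).const_smul _)
  have key := zero_of_cusp (k := 8) (by norm_num)
    (serreDerivative 6 E₆ + (1 / 2 : ℂ) • ((E₄ : ℍ → ℂ) * E₄)) hmd
    (fun γ => by
      rw [SlashAction.add_slash, ModularForm.SL_smul_slash]
      have h4 : (E₄ : ℍ → ℂ) ∣[(4 : ℤ)] γ = E₄ := E₄.slash_action_eq' _ ⟨γ, rfl⟩
      have h6 : (E₆ : ℍ → ℂ) ∣[(6 : ℤ)] γ = E₆ := E₆.slash_action_eq' _ ⟨γ, rfl⟩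
      have := serreDerivative_slash_invariant hd6 h6
      rw [show ((6 : ℤ) : ℂ) = 6 by norm_num, show (6 + 2 : ℤ) = 8 by norm_num] at this
      have h8 := ModularForm.mul_slash_SL2 4 4 γ (E₄ : ℍ → ℂ) E₄
      rw [show (4 + 4 : ℤ) = 8 by norm_num, h4] at h8
      rw [this, h8])
    (by
      have h4 := tendsto_E (k := 4) (by norm_num) ⟨2, rfl⟩
      have := (tendsto_serre 6 hd6 (tendsto_E (by norm_num) ⟨3, rfl⟩)).add
        ((h4.mul h4).const_smul (1 / 2 : ℂ))
      convert! this using 2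
      norm_num)
  have := congrFun key z
  simp only [Pi.add_apply, Pi.smul_apply, smul_eq_mul, Pi.zero_apply, Pi.mul_apply] at this
  linear_combination this

lemma GTwo_eq (z : ℍ) : GTwo z = - (1 / 12) * E2 z := by
  have h := tsum_pow_div_one_sub_eq_tsum_sigma (norm_exp_two_pi_I_lt_one z) 1
  rw [tsum_pnat_eq_tsum_succ (f := fun n : ℕ ↦ (n : ℂ) ^ 1 * Complex.exp (2 * Real.pi * I * z) ^ n /
    (1 - Complex.exp (2 * Real.pi * I * z) ^ n))] at h
  rw [E2_eq_tsum_cexp, ← h, GTwo]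
  push_cast
  simp only [pow_one]
  ring

lemma GFour_eq (z : ℍ) : GFour z = (1 / 720) * E₄ z := by
  have h := tsum_pow_div_one_sub_eq_tsum_sigma (norm_exp_two_pi_I_lt_one z) 3
  rw [tsum_pnat_eq_tsum_succ (f := fun n : ℕ ↦ (n : ℂ) ^ 3 * Complex.exp (2 * Real.pi * I * z) ^ n /
    (1 - Complex.exp (2 * Real.pi * I * z) ^ n))] at h
  have h2 := q_expansion_bernoulli (k := 4) (by norm_num) ⟨2, rfl⟩ z
  simp only [zpow_natCast] at h2
  rw [h2, show bernoulli 4 = -1 / 30 by decide +kernel, ← h, GFour]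
  push_cast
  ring

/-- `E₄` as a function on `ℂ`. -/
noncomputable def A (τ : ℂ) : ℂ := E₄ (ofComplex τ)

/-- `E₆` as a function on `ℂ`. -/
noncomputable def B (τ : ℂ) : ℂ := E₆ (ofComplex τ)

lemma GFour_A {τ : ℂ} (h : 0 < τ.im) : GFour τ = (1 / 720) * A τ := by
  rw [A, ofComplex_apply_of_im_pos h]; exact GFour_eq ⟨τ, h⟩

lemma hasDeriv_A {τ : ℂ} (h : 0 < τ.im) :
    HasDerivAt A (2 * (Real.pi : ℂ) * I * (-4 * GTwo τ * A τ - 1 / 3 * B τ)) τ := by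
  have hd4 : MDiff (E₄ : ℍ → ℂ) := ModularFormClass.holo E₄
  have h1 := (mdifferentiableAt_iff.mp (hd4 ⟨τ, h⟩)).hasDerivAt
  have h2 := serre_E4 ⟨τ, h⟩
  have h3 := GTwo_eq ⟨τ, h⟩
  simp only [serreDerivative_apply, normalizedDerivOfComplex] at h2
  have hpi : (2 * (Real.pi : ℂ) * I) ≠ 0 := Complex.two_pi_I_ne_zero
  convert! h1 using 1
  have h4 : deriv ((E₄ : ℍ → ℂ) ∘ ofComplex) τ =
      2 * (Real.pi : ℂ) * I * ((2 * (Real.pi : ℂ) * I)⁻¹ * deriv ((E₄ : ℍ → ℂ) ∘ ofComplex) τ) := by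
    rw [mul_inv_cancel_left₀ hpi]
  change _ = deriv ((E₄ : ℍ → ℂ) ∘ ofComplex) τ
  rw [h4]
  congr 1
  rw [A, B, ofComplex_apply_of_im_pos h]
  change GTwo τ = _ at h3
  rw [h3]
  linear_combination -h2

lemma hasDeriv_B {τ : ℂ} (h : 0 < τ.im) :
    HasDerivAt B (2 * (Real.pi : ℂ) * I * (-6 * GTwo τ * B τ - 1 / 2 * A τ ^ 2)) τ := by
  have hd6 : MDiff (E₆ : ℍ → ℂ) := ModularFormClass.holo E₆
  have h1 := (mdifferentiableAt_iff.mp (hd6 ⟨τ, h⟩)).hasDerivAt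
  have h2 := serre_E6 ⟨τ, h⟩
  have h3 := GTwo_eq ⟨τ, h⟩
  simp only [serreDerivative_apply, normalizedDerivOfComplex] at h2
  have hpi : (2 * (Real.pi : ℂ) * I) ≠ 0 := Complex.two_pi_I_ne_zero
  convert! h1 using 1
  have h4 : deriv ((E₆ : ℍ → ℂ) ∘ ofComplex) τ =
      2 * (Real.pi : ℂ) * I * ((2 * (Real.pi : ℂ) * I)⁻¹ * deriv ((E₆ : ℍ → ℂ) ∘ ofComplex) τ) := by
    rw [mul_inv_cancel_left₀ hpi]
  change _ = deriv ((E₆ : ℍ → ℂ) ∘ ofComplex) τ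
  rw [h4]
  congr 1
  rw [A, B, ofComplex_apply_of_im_pos h]
  change GTwo τ = _ at h3
  rw [h3]
  linear_combination -h2

lemma ramD_mono (f : ℂ → ℂ) (c1 c2 c3 : ℂ) (a1 b1 a2 b2 a3 b3 : ℕ) (w : ℂ)
    (hw1 : (4 * a1 + 6 * b1 : ℂ) = w) (hw2 : (4 * a2 + 6 * b2 : ℂ) = w)
    (hw3 : (4 * a3 + 6 * b3 : ℂ) = w)
    (hf : ∀ τ : ℂ, 0 < τ.im → f τ = c1 * (A τ ^ a1 * B τ ^ b1) + c2 * (A τ ^ a2 * B τ ^ b2) +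
      c3 * (A τ ^ a3 * B τ ^ b3)) (τ : ℂ) (h : 0 < τ.im) :
    ramD f τ + w * GTwo τ * f τ =
      c1 * (-(a1 / 3) * (A τ ^ (a1 - 1) * B τ ^ (b1 + 1)) - b1 / 2 * (A τ ^ (a1 + 2) * B τ ^ (b1 - 1))) +
      c2 * (-(a2 / 3) * (A τ ^ (a2 - 1) * B τ ^ (b2 + 1)) - b2 / 2 * (A τ ^ (a2 + 2) * B τ ^ (b2 - 1))) +
      c3 * (-(a3 / 3) * (A τ ^ (a3 - 1) * B τ ^ (b3 + 1)) - b3 / 2 * (A τ ^ (a3 + 2) * B τ ^ (b3 - 1))) := by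
  have hmon : ∀ (c w : ℂ) (a b : ℕ), (4 * a + 6 * b : ℂ) = w →
      HasDerivAt (fun s => c * (A s ^ a * B s ^ b)) (2 * (Real.pi : ℂ) * I *
        (c * (-(a / 3) * (A τ ^ (a - 1) * B τ ^ (b + 1)) - b / 2 * (A τ ^ (a + 2) * B τ ^ (b - 1)))
          - w * GTwo τ * (c * (A τ ^ a * B τ ^ b)))) τ := by
    intro c w a b hw
    have := (((hasDeriv_A h).pow a).mul ((hasDeriv_B h).pow b)).const_mul c
    convert! this using 1
    subst hw
    simp only [Pi.pow_apply]
    rcases a with _ | a <;> rcases b with _ | b <;> push_cast <;>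
      simp <;> ring
  have h1 := ((hmon c1 w a1 b1 hw1).add (hmon c2 w a2 b2 hw2)).add (hmon c3 w a3 b3 hw3)
  have h2 : f =ᶠ[𝓝 τ] ((fun s => c1 * (A s ^ a1 * B s ^ b1)) + (fun s => c2 * (A s ^ a2 * B s ^ b2)) +
      (fun s => c3 * (A s ^ a3 * B s ^ b3))) := by
    filter_upwards [isOpen_upperHalfPlaneSet.mem_nhds h] with s hs
    exact hf s hs
  have hpi : (2 * (Real.pi : ℂ) * I) ≠ 0 := Complex.two_pi_I_ne_zero
  rw [ramD, h2.deriv_eq, h1.deriv, hf τ h, ← mul_add, ← mul_add, inv_mul_cancel_left₀ hpi]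
  ring

lemma tendsto_A : Tendsto (fun z : ℍ => A z) atImInfty (𝓝 1) := by
  simpa [A] using! tendsto_E (k := 4) (by norm_num) ⟨2, rfl⟩

lemma tendsto_B : Tendsto (fun z : ℍ => B z) atImInfty (𝓝 1) := by
  simpa [B] using! tendsto_E (k := 6) (by norm_num) ⟨3, rfl⟩

lemma final (a b : ℂ) (h : ∀ τ : ℂ, 0 < τ.im →
    a * (A τ ^ 5 * B τ ^ 1) + b * (A τ ^ 2 * B τ ^ 3) = 0) : b = 0 := by
  have hlim : Tendsto (fun z : ℍ => a * (A z ^ 5 * B z ^ 1) + b * (A z ^ 2 * B z ^ 3)) atImInfty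
      (𝓝 (a * (1 ^ 5 * 1 ^ 1) + b * (1 ^ 2 * 1 ^ 3))) :=
    (((tendsto_A.pow 5).mul (tendsto_B.pow 1)).const_mul a).add
      (((tendsto_A.pow 2).mul (tendsto_B.pow 3)).const_mul b)
  have hab : a * (1 ^ 5 * 1 ^ 1) + b * (1 ^ 2 * 1 ^ 3) = 0 := by
    refine tendsto_nhds_unique hlim ?_
    simp only [fun z : ℍ => h z z.im_pos]
    exact tendsto_const_nhds
  obtain ⟨z, hA, hB⟩ := ((tendsto_A.eventually_ne one_ne_zero).and
    (tendsto_B.eventually_ne one_ne_zero)).exists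
  have hΔ := discriminant_eq_E₄_cube_sub_E₆_sq z
  have hΔ0 := discriminant_ne_zero z
  have h1 := h z z.im_pos
  have h2 : A z = E₄ z := by simp [A]
  have h3 : B z = E₆ z := by simp [B]
  rw [← h2, ← h3] at hΔ
  have h4 : b * (A z ^ 2 * B z * ModularForm.discriminant z) = 0 := by
    rw [hΔ]
    linear_combination (-1 / 1728) * h1 + (1 / 1728) * (A z ^ 5 * B z) * hab
  rcases mul_eq_zero.mp h4 with h5 | h5
  · exact h5
  · exact absurd h5 (by positivity)

end Stmt12Aux

/-- for `m = 12` and `Q = λ·G₄`, the last term `R₁₂` of the recursion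
`R₁ = 12Q`, `R₂ = 12(ΘQ + 4G₂Q)`, `R_{i+1} = ΘR_i + (2i+2)G₂R_i + (i+1)(12−i)QR_{i−1}`
vanishes identically on `ℍ` if and only if `λ ∈ {−11/5, −25/4, −15, −40, 0}`. -/
theorem stmt_12 (lam : ℂ) (R : ℕ → ℂ → ℂ)
    (hR1 : R 1 = fun τ => 12 * (lam * GFour τ))
    (hR2 : R 2 = fun τ => 12 * (ramD (fun s => lam * GFour s) τ + 4 * GTwo τ * (lam * GFour τ)))
    (hRrec : ∀ i : ℕ, 2 ≤ i → i ≤ 11 →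
      R (i + 1) = fun τ => ramD (R i) τ + (2 * (i : ℂ) + 2) * GTwo τ * R i τ +
        ((i : ℂ) + 1) * (12 - (i : ℂ)) * (lam * GFour τ) * R (i - 1) τ) :
    (∀ τ : ℂ, 0 < τ.im → R 12 τ = 0) ↔
      lam ∈ ({-11 / 5, -25 / 4, -15, -40, 0} : Set ℂ) := by
  have r1 : ∀ τ : ℂ, 0 < τ.im → R 1 τ = ((1 / 60) * lam ^ 1) * (Stmt12Aux.A τ ^ 1 * Stmt12Aux.B τ ^ 0) +
        0 * (Stmt12Aux.A τ ^ 1 * Stmt12Aux.B τ ^ 0) +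
        0 * (Stmt12Aux.A τ ^ 1 * Stmt12Aux.B τ ^ 0) := by
    intro τ h
    simp only [hR1, Stmt12Aux.GFour_A h]
    ring
  have q1 : ∀ τ : ℂ, 0 < τ.im → lam * GFour τ =
        ((1 / 720) * lam ^ 1) * (Stmt12Aux.A τ ^ 1 * Stmt12Aux.B τ ^ 0) + 0 * (Stmt12Aux.A τ ^ 1 * Stmt12Aux.B τ ^ 0) +
        0 * (Stmt12Aux.A τ ^ 1 * Stmt12Aux.B τ ^ 0) := by
    intro τ h
    simp only [Stmt12Aux.GFour_A h]
    ring
  have r2 : ∀ τ : ℂ, 0 < τ.im → R 2 τ = ((-1 / 180) * lam ^ 1) * (Stmt12Aux.A τ ^ 0 * Stmt12Aux.B τ ^ 1) +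
        0 * (Stmt12Aux.A τ ^ 0 * Stmt12Aux.B τ ^ 1) +
        0 * (Stmt12Aux.A τ ^ 0 * Stmt12Aux.B τ ^ 1) := by
    intro τ h
    have e := Stmt12Aux.ramD_mono (fun s => lam * GFour s) _ _ _ _ _ _ _ _ _ 4 (by norm_num) (by norm_num)
      (by norm_num) q1 τ h
    simp only [hR2]
    rw [e]
    norm_num
    ring
  have r3 : ∀ τ : ℂ, 0 < τ.im → R 3 τ = ((1 / 360) * lam ^ 1 + (1 / 1440) * lam ^ 2) * (Stmt12Aux.A τ ^ 2 * Stmt12Aux.B τ ^ 0) +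
        0 * (Stmt12Aux.A τ ^ 2 * Stmt12Aux.B τ ^ 0) +
        0 * (Stmt12Aux.A τ ^ 2 * Stmt12Aux.B τ ^ 0) := by
    intro τ h
    have e := Stmt12Aux.ramD_mono (R 2) _ _ _ _ _ _ _ _ _ (2 * ((2 : ℕ) : ℂ) + 2) (by norm_num) (by norm_num)
      (by norm_num) r2 τ h
    have s := congrFun (hRrec 2 (by norm_num) (by norm_num)) τ
    simp only [Nat.reduceAdd, Nat.reduceSub] at s
    rw [s, e, r1 τ h, Stmt12Aux.GFour_A h]
    norm_num
    ring
  have r4 : ∀ τ : ℂ, 0 < τ.im → R 4 τ = ((-1 / 540) * lam ^ 1 + (-1 / 1350) * lam ^ 2) * (Stmt12Aux.A τ ^ 1 * Stmt12Aux.B τ ^ 1) +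
        0 * (Stmt12Aux.A τ ^ 1 * Stmt12Aux.B τ ^ 1) +
        0 * (Stmt12Aux.A τ ^ 1 * Stmt12Aux.B τ ^ 1) := by
    intro τ h
    have e := Stmt12Aux.ramD_mono (R 3) _ _ _ _ _ _ _ _ _ (2 * ((3 : ℕ) : ℂ) + 2) (by norm_num) (by norm_num)
      (by norm_num) r3 τ h
    have s := congrFun (hRrec 3 (by norm_num) (by norm_num)) τ
    simp only [Nat.reduceAdd, Nat.reduceSub] at s
    rw [s, e, r2 τ h, Stmt12Aux.GFour_A h]
    norm_num
    ring
  have r5 : ∀ τ : ℂ, 0 < τ.im → R 5 τ = ((1 / 1080) * lam ^ 1 + (17 / 32400) * lam ^ 2 + (1 / 25920) * lam ^ 3) * (Stmt12Aux.A τ ^ 3 * Stmt12Aux.B τ ^ 0) +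
        ((1 / 1620) * lam ^ 1 + (1 / 4050) * lam ^ 2) * (Stmt12Aux.A τ ^ 0 * Stmt12Aux.B τ ^ 2) +
        0 * (Stmt12Aux.A τ ^ 3 * Stmt12Aux.B τ ^ 0) := by
    intro τ h
    have e := Stmt12Aux.ramD_mono (R 4) _ _ _ _ _ _ _ _ _ (2 * ((4 : ℕ) : ℂ) + 2) (by norm_num) (by norm_num)
      (by norm_num) r4 τ h
    have s := congrFun (hRrec 4 (by norm_num) (by norm_num)) τ
    simp only [Nat.reduceAdd, Nat.reduceSub] at s
    rw [s, e, r3 τ h, Stmt12Aux.GFour_A h]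
    norm_num
    ring
  have r6 : ∀ τ : ℂ, 0 < τ.im → R 6 τ = ((-1 / 648) * lam ^ 1 + (-19 / 21600) * lam ^ 2 + (-53 / 648000) * lam ^ 3) * (Stmt12Aux.A τ ^ 2 * Stmt12Aux.B τ ^ 1) +
        0 * (Stmt12Aux.A τ ^ 2 * Stmt12Aux.B τ ^ 1) +
        0 * (Stmt12Aux.A τ ^ 2 * Stmt12Aux.B τ ^ 1) := by
    intro τ h
    have e := Stmt12Aux.ramD_mono (R 5) _ _ _ _ _ _ _ _ _ (2 * ((5 : ℕ) : ℂ) + 2) (by norm_num) (by norm_num)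
      (by norm_num) r5 τ h
    have s := congrFun (hRrec 5 (by norm_num) (by norm_num)) τ
    simp only [Nat.reduceAdd, Nat.reduceSub] at s
    rw [s, e, r4 τ h, Stmt12Aux.GFour_A h]
    norm_num
    ring
  have r7 : ∀ τ : ℂ, 0 < τ.im → R 7 τ = ((1 / 1296) * lam ^ 1 + (1 / 2025) * lam ^ 2 + (139 / 1944000) * lam ^ 3 + (7 / 3110400) * lam ^ 4) * (Stmt12Aux.A τ ^ 4 * Stmt12Aux.B τ ^ 0) +
        ((1 / 972) * lam ^ 1 + (121 / 194400) * lam ^ 2 + (67 / 972000) * lam ^ 3) * (Stmt12Aux.A τ ^ 1 * Stmt12Aux.B τ ^ 2) +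
        0 * (Stmt12Aux.A τ ^ 4 * Stmt12Aux.B τ ^ 0) := by
    intro τ h
    have e := Stmt12Aux.ramD_mono (R 6) _ _ _ _ _ _ _ _ _ (2 * ((6 : ℕ) : ℂ) + 2) (by norm_num) (by norm_num)
      (by norm_num) r6 τ h
    have s := congrFun (hRrec 6 (by norm_num) (by norm_num)) τ
    simp only [Nat.reduceAdd, Nat.reduceSub] at s
    rw [s, e, r5 τ h, Stmt12Aux.GFour_A h]
    norm_num
    ring
  have r8 : ∀ τ : ℂ, 0 < τ.im → R 8 τ = ((-1 / 486) * lam ^ 1 + (-797 / 583200) * lam ^ 2 + (-1243 / 5832000) * lam ^ 3 + (-11 / 1458000) * lam ^ 4) * (Stmt12Aux.A τ ^ 3 * Stmt12Aux.B τ ^ 1) +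
        ((-1 / 2916) * lam ^ 1 + (-121 / 583200) * lam ^ 2 + (-67 / 2916000) * lam ^ 3) * (Stmt12Aux.A τ ^ 0 * Stmt12Aux.B τ ^ 3) +
        0 * (Stmt12Aux.A τ ^ 3 * Stmt12Aux.B τ ^ 1) := by
    intro τ h
    have e := Stmt12Aux.ramD_mono (R 7) _ _ _ _ _ _ _ _ _ (2 * ((7 : ℕ) : ℂ) + 2) (by norm_num) (by norm_num)
      (by norm_num) r7 τ h
    have s := congrFun (hRrec 7 (by norm_num) (by norm_num)) τ
    simp only [Nat.reduceAdd, Nat.reduceSub] at s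
    rw [s, e, r6 τ h, Stmt12Aux.GFour_A h]
    norm_num
    ring
  have r9 : ∀ τ : ℂ, 0 < τ.im → R 9 τ = ((1 / 972) * lam ^ 1 + (421 / 583200) * lam ^ 2 + (1531 / 11664000) * lam ^ 3 + (857 / 116640000) * lam ^ 4 + (7 / 62208000) * lam ^ 5) * (Stmt12Aux.A τ ^ 5 * Stmt12Aux.B τ ^ 0) +
        ((5 / 1944) * lam ^ 1 + (2017 / 1166400) * lam ^ 2 + (3251 / 11664000) * lam ^ 3 + (641 / 58320000) * lam ^ 4) * (Stmt12Aux.A τ ^ 2 * Stmt12Aux.B τ ^ 2) +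
        0 * (Stmt12Aux.A τ ^ 5 * Stmt12Aux.B τ ^ 0) := by
    intro τ h
    have e := Stmt12Aux.ramD_mono (R 8) _ _ _ _ _ _ _ _ _ (2 * ((8 : ℕ) : ℂ) + 2) (by norm_num) (by norm_num)
      (by norm_num) r8 τ h
    have s := congrFun (hRrec 8 (by norm_num) (by norm_num)) τ
    simp only [Nat.reduceAdd, Nat.reduceSub] at s
    rw [s, e, r7 τ h, Stmt12Aux.GFour_A h]
    norm_num
    ring
  have r10 : ∀ τ : ℂ, 0 < τ.im → R 10 τ = ((-25 / 5832) * lam ^ 1 + (-10561 / 3499200) * lam ^ 2 + (-38801 / 69984000) * lam ^ 3 + (-22477 / 699840000) * lam ^ 4 + (-281 / 559872000) * lam ^ 5) * (Stmt12Aux.A τ ^ 4 * Stmt12Aux.B τ ^ 1) +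
        ((-5 / 2916) * lam ^ 1 + (-1021 / 874800) * lam ^ 2 + (-13609 / 69984000) * lam ^ 3 + (-2899 / 349920000) * lam ^ 4) * (Stmt12Aux.A τ ^ 1 * Stmt12Aux.B τ ^ 3) +
        0 * (Stmt12Aux.A τ ^ 4 * Stmt12Aux.B τ ^ 1) := by
    intro τ h
    have e := Stmt12Aux.ramD_mono (R 9) _ _ _ _ _ _ _ _ _ (2 * ((9 : ℕ) : ℂ) + 2) (by norm_num) (by norm_num)
      (by norm_num) r9 τ h
    have s := congrFun (hRrec 9 (by norm_num) (by norm_num)) τ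
    simp only [Nat.reduceAdd, Nat.reduceSub] at s
    rw [s, e, r8 τ h, Stmt12Aux.GFour_A h]
    norm_num
    ring
  have r11 : ∀ τ : ℂ, 0 < τ.im → R 11 τ = ((25 / 11664) * lam ^ 1 + (10781 / 6998400) * lam ^ 2 + (25133 / 83980800) * lam ^ 3 + (5267 / 262440000) * lam ^ 4 + (39929 / 83980800000) * lam ^ 5 + (77 / 22394880000) * lam ^ 6) * (Stmt12Aux.A τ ^ 6 * Stmt12Aux.B τ ^ 0) +
        ((145 / 17496) * lam ^ 1 + (61447 / 10497600) * lam ^ 2 + (12641 / 11664000) * lam ^ 3 + (9917 / 155520000) * lam ^ 4 + (21101 / 20995200000) * lam ^ 5) * (Stmt12Aux.A τ ^ 3 * Stmt12Aux.B τ ^ 2) +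
        ((5 / 8748) * lam ^ 1 + (1021 / 2624400) * lam ^ 2 + (13609 / 209952000) * lam ^ 3 + (2899 / 1049760000) * lam ^ 4) * (Stmt12Aux.A τ ^ 0 * Stmt12Aux.B τ ^ 4) := by
    intro τ h
    have e := Stmt12Aux.ramD_mono (R 10) _ _ _ _ _ _ _ _ _ (2 * ((10 : ℕ) : ℂ) + 2) (by norm_num) (by norm_num)
      (by norm_num) r10 τ h
    have s := congrFun (hRrec 10 (by norm_num) (by norm_num)) τ
    simp only [Nat.reduceAdd, Nat.reduceSub] at s
    rw [s, e, r9 τ h, Stmt12Aux.GFour_A h]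
    norm_num
    ring
  have r12 : ∀ τ : ℂ, 0 < τ.im → R 12 τ = ((-55 / 4374) * lam ^ 1 + (-4727 / 524880) * lam ^ 2 + (-90941 / 52488000) * lam ^ 3 + (-4949 / 43740000) * lam ^ 4 + (-3269 / 1312200000) * lam ^ 5 + (-1 / 65610000) * lam ^ 6) * (Stmt12Aux.A τ ^ 5 * Stmt12Aux.B τ ^ 1) +
        ((-55 / 5832) * lam ^ 1 + (-4661 / 699840) * lam ^ 2 + (-719 / 583200) * lam ^ 3 + (-47 / 648000) * lam ^ 4 + (-1 / 874800) * lam ^ 5) * (Stmt12Aux.A τ ^ 2 * Stmt12Aux.B τ ^ 3) +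
        0 * (Stmt12Aux.A τ ^ 5 * Stmt12Aux.B τ ^ 1) := by
    intro τ h
    have e := Stmt12Aux.ramD_mono (R 11) _ _ _ _ _ _ _ _ _ (2 * ((11 : ℕ) : ℂ) + 2) (by norm_num) (by norm_num)
      (by norm_num) r11 τ h
    have s := congrFun (hRrec 11 (by norm_num) (by norm_num)) τ
    simp only [Nat.reduceAdd, Nat.reduceSub] at s
    rw [s, e, r10 τ h, Stmt12Aux.GFour_A h]
    norm_num
    ring
  constructor
  · intro h
    have hb := Stmt12Aux.final ((-55 / 4374) * lam ^ 1 + (-4727 / 524880) * lam ^ 2 + (-90941 / 52488000) * lam ^ 3 + (-4949 / 43740000) * lam ^ 4 + (-3269 / 1312200000) * lam ^ 5 + (-1 / 65610000) * lam ^ 6)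
      ((-55 / 5832) * lam ^ 1 + (-4661 / 699840) * lam ^ 2 + (-719 / 583200) * lam ^ 3 + (-47 / 648000) * lam ^ 4 + (-1 / 874800) * lam ^ 5)
      (fun τ hτ => by rw [← h τ hτ, r12 τ hτ]; ring)
    have hb2 : (lam + 11 / 5) * ((lam + 25 / 4) * ((lam + 15) * ((lam + 40) * lam))) = 0 := by
      linear_combination (-874800) * hb
    simp only [Set.mem_insert_iff, Set.mem_singleton_iff]
    rcases mul_eq_zero.mp hb2 with h1 | h1
    · left; linear_combination h1
    rcases mul_eq_zero.mp h1 with h1 | h1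
    · right; left; linear_combination h1
    rcases mul_eq_zero.mp h1 with h1 | h1
    · right; right; left; linear_combination h1
    rcases mul_eq_zero.mp h1 with h1 | h1
    · right; right; right; left; linear_combination h1
    · right; right; right; right; exact h1
  · intro h τ hτ
    rw [r12 τ hτ]
    simp only [Set.mem_insert_iff, Set.mem_singleton_iff] at h
    rcases h with h | h | h | h | h <;> subst h <;> ring
end
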